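/- arXiv:2305.09140 — 7 statements merged into one kernel-verified Lean document; each statement's English description precedes it below -/
import Mathlib

section
/- Let n = 2 or, more generally, let λ = (λ₁,…,λₙ) have only two distinct values λ₁ and λₙ (i.e. λ_i ∈ {λ₁, λₙ} for all i) with λ₁ ≥ λₙ > 0. Then the average rate of convergence of exact line search gradient descent tends to 0 as the condition number λ₁/λₙ tends to infinity: for every ε > 0 there exists a₀ > 0 such that whenever λₙ/λ₁ < a₀, one has ∫_{S^{n−1}} ρ*(x,λ) dμ(x) < ε. -/
open MeasureTheory Filter Finset Real Metric

noncomputable section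

/-- `qform lam k x = xᵀ Aᵏ x` for `A = diag lam`. -/
def qform {n : ℕ} (lam : Fin n → ℝ) (k : ℕ) (x : Fin n → ℝ) : ℝ :=
  ∑ i, lam i ^ k * x i ^ 2

/-- Exact line search gradient descent map for `f(x) = ½ xᵀAx`, `A = diag lam`;
`GD 0 = 0`. -/
def GD {n : ℕ} (lam : Fin n → ℝ) (x : Fin n → ℝ) : Fin n → ℝ :=
  if x = 0 then 0 else fun i => x i - qform lam 2 x / qform lam 3 x * (lam i * x i)

/-- One-step shrinking factor `ρ(x, λ)`, with the convention `ρ(0, λ) = 0`. -/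
def shrink {n : ℕ} (lam : Fin n → ℝ) (x : Fin n → ℝ) : ℝ :=
  if x = 0 then 0 else
    Real.sqrt (1 - (qform lam 2 x) ^ 2 / (qform lam 1 x * qform lam 3 x))

/-- Rate of convergence `ρ*(x⁰, λ)` of exact line search gradient descent from seed `x⁰`. -/
def rocGD {n : ℕ} (lam : Fin n → ℝ) (x0 : Fin n → ℝ) : ℝ :=
  Filter.limsup
    (fun k : ℕ => (∏ j ∈ Finset.range k, shrink lam ((GD lam)^[j] x0)) ^ ((k : ℝ)⁻¹))
    Filter.atTop

/-- The uniform (rotation invariant) probability measure on the unit sphere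
`S^{n-1} ⊆ ℝⁿ`. -/
def sphereUniform (n : ℕ) : Measure (sphere (0 : EuclideanSpace ℝ (Fin n)) 1) :=
  ((volume : Measure (EuclideanSpace ℝ (Fin n))).toSphere Set.univ)⁻¹ •
    (volume : Measure (EuclideanSpace ℝ (Fin n))).toSphere

/-- The average rate of convergence `∫_{S^{n-1}} ρ*(x, λ) dμ(x)`. -/
def avgROC (n : ℕ) (lam : Fin n → ℝ) : ℝ :=
  ∫ x : sphere (0 : EuclideanSpace ℝ (Fin n)) 1,
    rocGD lam (x : EuclideanSpace ℝ (Fin n)) ∂(sphereUniform n)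

/-- If `lam` takes only the values `L` and `l`, then every weighted sum `∑ f (lam i) * x i ^ 2`
depends on `x` only through its squared masses `p` and `q` on the two eigenspaces. -/
theorem exists_eigenspace_masses {n : ℕ} {lam : Fin n → ℝ} {L l : ℝ}
    (h : ∀ i, lam i = L ∨ lam i = l) (x : Fin n → ℝ) :
    ∃ p q : ℝ, 0 ≤ p ∧ 0 ≤ q ∧ (∀ i, lam i = L → x i ^ 2 ≤ p) ∧
      ∀ f : ℝ → ℝ, ∑ i, f (lam i) * x i ^ 2 = f L * p + f l * q := by
  classical
  refine ⟨∑ i, if lam i = L then x i ^ 2 else 0, ∑ i, if lam i = L then 0 else x i ^ 2,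
    Finset.sum_nonneg fun i _ => by positivity, Finset.sum_nonneg fun i _ => by positivity, ?_, ?_⟩
  · intro i hi
    have := Finset.single_le_sum (f := fun i => if lam i = L then x i ^ 2 else 0)
      (fun i _ => by positivity) (Finset.mem_univ i)
    simpa [hi] using this
  · intro f
    rw [Finset.mul_sum, Finset.mul_sum, ← Finset.sum_add_distrib]
    refine Finset.sum_congr rfl fun i _ => ?_
    by_cases hi : lam i = L
    · simp [hi]
    · simp [(h i).resolve_left hi, (h i).resolve_left hi ▸ hi]

theorem eq_zero_of_sum_sq_eq_zero {n : ℕ} {x : Fin n → ℝ} (h : ∑ i, x i ^ 2 = 0) : x = 0 := by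
  funext i
  have := (Finset.sum_eq_zero_iff_of_nonneg fun i _ => sq_nonneg (x i)).1 h i (Finset.mem_univ i)
  simpa using this

/-- The squared shrinking factor in terms of the squared masses `p`, `q` of the seed on the
eigenspaces of `L` and `l`. -/
def shrinkSq (L l p q : ℝ) : ℝ :=
  L * l * (L - l) ^ 2 * (p * q) / ((L * p + l * q) * (L ^ 3 * p + l ^ 3 * q))

theorem shrink_eq_sqrt_shrinkSq {n : ℕ} {lam : Fin n → ℝ} {L l : ℝ} (hl : 0 < l) (hL : l < L)
    {x : Fin n → ℝ} (hx : x ≠ 0) {p q : ℝ} (hp : 0 ≤ p) (hq : 0 ≤ q)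
    (h : ∀ k, qform lam k x = L ^ k * p + l ^ k * q) :
    shrink lam x = √(shrinkSq L l p q) := by
  have hL0 : 0 < L := hl.trans hL
  have hpq : 0 < p ∨ 0 < q := by
    by_contra! hc
    have h0 := h 0
    simp only [qform, pow_zero, one_mul] at h0
    exact hx (eq_zero_of_sum_sq_eq_zero (by linarith))
  have h1 : 0 < L * p + l * q := by rcases hpq with hpq | hpq <;> positivity
  have h3 : 0 < L ^ 3 * p + l ^ 3 * q := by rcases hpq with hpq | hpq <;> positivity
  rw [shrink, if_neg hx, h, h, h, shrinkSq, pow_one, pow_one]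
  congr 1
  field_simp
  ring

theorem shrink_GD {n : ℕ} {lam : Fin n → ℝ} {L l : ℝ} (hl : 0 < l) (hL : l < L)
    (h : ∀ i, lam i = L ∨ lam i = l) (x : Fin n → ℝ) :
    shrink lam (GD lam x) = shrink lam x := by
  by_cases hx : x = 0
  · simp [hx, GD]
  have hL0 : 0 < L := hl.trans hL
  obtain ⟨p, q, hp, hq, -, hpq⟩ := exists_eigenspace_masses h x
  have hform : ∀ k, qform lam k x = L ^ k * p + l ^ k * q := fun k => hpq (fun t => t ^ k)
  set s := qform lam 2 x / qform lam 3 x with hs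
  have hGD : GD lam x = fun i => (1 - s * lam i) * x i := by
    rw [GD, if_neg hx]
    funext i
    ring
  have hform' : ∀ k, qform lam k (GD lam x) =
      L ^ k * ((1 - s * L) ^ 2 * p) + l ^ k * ((1 - s * l) ^ 2 * q) := by
    intro k
    have := hpq (fun t => t ^ k * (1 - s * t) ^ 2)
    simp only [qform, hGD, mul_pow, ← mul_assoc] at this ⊢
    exact this
  have h3 : 0 < L ^ 3 * p + l ^ 3 * q := by
    by_contra! hc
    have hLp := mul_nonneg (pow_pos hL0 3).le hp
    have hlq := mul_nonneg (pow_pos hl 3).le hq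
    have h1 : L ^ 3 * p = 0 := by linarith
    have h2 : l ^ 3 * q = 0 := by linarith
    have hp0 : p = 0 := by simpa [hL0.ne'] using h1
    have hq0 : q = 0 := by simpa [hl.ne'] using h2
    exact hx (eq_zero_of_sum_sq_eq_zero (by simpa [hp0, hq0] using hpq fun _ => 1))
  have hcL : 1 - s * L = -(l ^ 2 * (L - l) * q) / (L ^ 3 * p + l ^ 3 * q) := by
    rw [hs, hform, hform]
    field_simp
    ring
  have hcl : 1 - s * l = L ^ 2 * (L - l) * p / (L ^ 3 * p + l ^ 3 * q) := by
    rw [hs, hform, hform]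
    field_simp
    ring
  have hd : 0 < L - l := sub_pos.2 hL
  rw [shrink_eq_sqrt_shrinkSq hl hL hx hp hq hform]
  by_cases hzero : p * q = 0
  · have hy : GD lam x = 0 := by
      apply eq_zero_of_sum_sq_eq_zero
      have := hform' 0
      simp only [qform, pow_zero, one_mul] at this
      rw [this, hcL, hcl]
      rcases mul_eq_zero.1 hzero with h0 | h0 <;> simp [h0]
    simp [hy, shrink, shrinkSq, hzero]
  · have hp0 : 0 < p := hp.lt_of_ne' (left_ne_zero_of_mul hzero)
    have hq0 : 0 < q := hq.lt_of_ne' (right_ne_zero_of_mul hzero)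
    have hy : GD lam x ≠ 0 := by
      intro hy
      have := hform' 0
      rw [hy, hcL, hcl] at this
      simp only [qform, Pi.zero_apply, pow_zero, one_mul, ne_eq, OfNat.ofNat_ne_zero,
        not_false_eq_true, zero_pow, Finset.sum_const_zero, neg_div, neg_sq] at this
      have : 0 < (l ^ 2 * (L - l) * q / (L ^ 3 * p + l ^ 3 * q)) ^ 2 * p +
        (L ^ 2 * (L - l) * p / (L ^ 3 * p + l ^ 3 * q)) ^ 2 * q := by positivity
      linarith
    rw [shrink_eq_sqrt_shrinkSq hl hL hy (by positivity) (by positivity) hform', hcL, hcl]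
    congr 1
    set T := L ^ 3 * p + l ^ 3 * q with hT
    have e1 : L * ((-(l ^ 2 * (L - l) * q) / T) ^ 2 * p) + l * ((L ^ 2 * (L - l) * p / T) ^ 2 * q) =
        (L - l) ^ 2 * L * l * (p * q) / T := by
      field_simp
      rw [hT]
      ring
    have e3 : L ^ 3 * ((-(l ^ 2 * (L - l) * q) / T) ^ 2 * p) +
        l ^ 3 * ((L ^ 2 * (L - l) * p / T) ^ 2 * q) =
        (L - l) ^ 2 * L ^ 3 * l ^ 3 * (p * q) * (L * p + l * q) / T ^ 2 := by
      field_simp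
      ring
    have h1 : 0 < L * p + l * q := by positivity
    rw [shrinkSq, shrinkSq, e1, e3, ← hT]
    field_simp

theorem shrink_nonneg {n : ℕ} (lam x : Fin n → ℝ) : 0 ≤ shrink lam x := by
  unfold shrink
  split_ifs
  · exact le_rfl
  · exact Real.sqrt_nonneg _

/-- For two eigenvalues the shrinking factor is constant along the orbit, so it is the rate of
convergence. -/
theorem rocGD_eq_shrink {n : ℕ} {lam : Fin n → ℝ} {L l : ℝ} (hl : 0 < l) (hL : l < L)
    (h : ∀ i, lam i = L ∨ lam i = l) (x : Fin n → ℝ) :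
    rocGD lam x = shrink lam x := by
  have hiter : ∀ j : ℕ, shrink lam ((GD lam)^[j] x) = shrink lam x := by
    intro j
    induction j with
    | zero => rfl
    | succ j ih => rw [Function.iterate_succ_apply', shrink_GD hl hL h, ih]
  refine Tendsto.limsup_eq (tendsto_const_nhds.congr' ?_)
  filter_upwards [eventually_ne_atTop 0] with k hk
  simp only [hiter, Finset.prod_const, Finset.card_range]
  exact (Real.pow_rpow_inv_natCast (shrink_nonneg lam x) hk).symm

theorem shrink_le_of_norm_eq_one {n : ℕ} {lam : Fin n → ℝ} {L l : ℝ} (hl : 0 < l) (hL : l < L)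
    (h : ∀ i, lam i = L ∨ lam i = l) {x : Fin n → ℝ} (hx : ∑ i, x i ^ 2 = 1)
    {i : Fin n} (hi : lam i = L) :
    shrink lam x ≤ √(l / L / (l / L + x i ^ 2)) := by
  have hL0 : 0 < L := hl.trans hL
  obtain ⟨p, q, hp, hq, hip, hpq⟩ := exists_eigenspace_masses h x
  have hsum : p + q = 1 := by simpa [hx] using (hpq fun _ => 1).symm
  have hx0 : x ≠ 0 := by
    rintro rfl
    simp at hx
  rw [shrink_eq_sqrt_shrinkSq hl hL hx0 hp hq fun k => hpq fun t => t ^ k]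
  apply Real.sqrt_le_sqrt
  have hpq' : 0 < p ∨ 0 < q := by
    by_contra! hc
    linarith
  have h1 : 0 < L * p + l * q := by rcases hpq' with h' | h' <;> positivity
  have h3 : 0 < L ^ 3 * p + l ^ 3 * q := by rcases hpq' with h' | h' <;> positivity
  have hq1 : q ≤ 1 := by linarith
  have hstep : shrinkSq L l p q ≤ l * q / (L * p + l * q) := by
    rw [shrinkSq, div_le_div_iff₀ (by positivity) h1]
    have hle : (L - l) ^ 2 ≤ L ^ 2 := by nlinarith
    have : L * (L - l) ^ 2 * p ≤ L ^ 3 * p + l ^ 3 * q := by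
      have h4 := mul_le_mul_of_nonneg_left hle (mul_nonneg hL0.le hp)
      have h5 : 0 ≤ l ^ 3 * q := by positivity
      nlinarith
    have := mul_le_mul_of_nonneg_left this (mul_nonneg (mul_nonneg hl.le hq) h1.le)
    nlinarith
  refine hstep.trans ?_
  have hxi := hip i hi
  have hsq := sq_nonneg (x i)
  have e : l / L / (l / L + x i ^ 2) = l / (l + L * x i ^ 2) := by field_simp
  rw [e, div_le_div_iff₀ h1 (by positivity)]
  have h4 : q * x i ^ 2 ≤ p := by nlinarith
  nlinarith [mul_le_mul_of_nonneg_left h4 (mul_nonneg hl.le hL0.le)]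

theorem toSphere_ae_apply_ne_zero {n : ℕ} (i : Fin n) :
    ∀ᵐ x : sphere (0 : EuclideanSpace ℝ (Fin n)) 1 ∂(volume : Measure _).toSphere,
      (x : EuclideanSpace ℝ (Fin n)) i ≠ 0 := by
  have hmeas : MeasurableSet
      {x : sphere (0 : EuclideanSpace ℝ (Fin n)) 1 | (x : EuclideanSpace ℝ (Fin n)) i = 0} :=
    (isClosed_eq (by fun_prop) continuous_const).measurableSet
  let H : Submodule ℝ (EuclideanSpace ℝ (Fin n)) :=
    LinearMap.ker (EuclideanSpace.proj (𝕜 := ℝ) i : EuclideanSpace ℝ (Fin n) →L[ℝ] ℝ).toLinearMap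
  have hH : H ≠ ⊤ := by
    intro htop
    have : EuclideanSpace.single i (1 : ℝ) ∈ H := htop ▸ Submodule.mem_top
    simp [H] at this
  have hnull : (volume : Measure (EuclideanSpace ℝ (Fin n))) H = 0 :=
    Measure.addHaar_submodule _ H hH
  rw [ae_iff]
  simp only [ne_eq, not_not]
  rw [Measure.toSphere_apply' _ hmeas]
  refine mul_eq_zero_of_right _ (measure_mono_null ?_ hnull)
  rintro _ ⟨r, -, _, ⟨x, hx, rfl⟩, rfl⟩
  have hx' : (x : EuclideanSpace ℝ (Fin n)) i = 0 := hx
  simp [H, hx']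

theorem isFiniteMeasure_sphereUniform {n : ℕ} (hn : 0 < n) :
    IsFiniteMeasure (sphereUniform n) := by
  have : Nonempty (Fin n) := ⟨⟨0, hn⟩⟩
  refine Measure.smul_finite _ (ENNReal.inv_ne_top.2 ?_)
  rw [ne_eq, Measure.measure_univ_eq_zero]
  exact Measure.toSphere_ne_zero _

theorem tendsto_integral_sphereUniform_sqrt {n : ℕ} (i : Fin n) :
    Tendsto (fun a : ℝ => ∫ x : sphere (0 : EuclideanSpace ℝ (Fin n)) 1,
      √(a / (a + (x : EuclideanSpace ℝ (Fin n)) i ^ 2)) ∂(sphereUniform n))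
      (nhdsWithin 0 (Set.Ioi 0)) (nhds 0) := by
  have := isFiniteMeasure_sphereUniform (Fin.pos i)
  have hlim := tendsto_integral_filter_of_dominated_convergence (μ := sphereUniform n)
    (l := nhdsWithin (0 : ℝ) (Set.Ioi 0))
    (F := fun (a : ℝ) (x : sphere (0 : EuclideanSpace ℝ (Fin n)) 1) =>
      √(a / (a + (x : EuclideanSpace ℝ (Fin n)) i ^ 2)))
    (f := fun _ => 0) (fun _ => (1 : ℝ)) ?_ ?_ (integrable_const _) ?_
  · simpa using hlim
  · refine Eventually.of_forall fun a => Measurable.aestronglyMeasurable ?_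
    fun_prop
  · filter_upwards [self_mem_nhdsWithin] with a ha
    refine Eventually.of_forall fun x => ?_
    have ha : 0 < a := ha
    rw [Real.norm_of_nonneg (Real.sqrt_nonneg _), Real.sqrt_le_one]
    exact div_le_one_of_le₀ (le_add_of_nonneg_right (sq_nonneg _)) (by positivity)
  · refine Measure.ae_smul_measure ?_ _
    filter_upwards [toSphere_ae_apply_ne_zero i] with x hx
    have hc : ContinuousAt (fun a : ℝ => √(a / (a + (x : EuclideanSpace ℝ (Fin n)) i ^ 2))) 0 := by
      refine (ContinuousAt.div (by fun_prop) (by fun_prop) ?_).sqrt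
      simpa using hx
    have := hc.tendsto.mono_left (nhdsWithin_le_nhds (s := Set.Ioi 0))
    simpa using this

/-- if `λ` takes only the two values `λ₁ ≥ λₙ > 0`, the average ROC of
exact line search gradient descent tends to `0` as the condition number tends to `∞`. -/
theorem average_roc_tendsto_zero_of_two_eigenvalues (n : ℕ) (hn : 2 ≤ n)
    (ε : ℝ) (hε : 0 < ε) :
    ∃ a₀ > (0 : ℝ), ∀ lam : Fin n → ℝ,
      (∀ i j : Fin n, i ≤ j → lam j ≤ lam i) →
      0 < lam ⟨n - 1, by omega⟩ →
      (∀ i, lam i = lam ⟨0, by omega⟩ ∨ lam i = lam ⟨n - 1, by omega⟩) →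
      lam ⟨n - 1, by omega⟩ / lam ⟨0, by omega⟩ < a₀ →
      avgROC n lam < ε := by
  have hev := (tendsto_integral_sphereUniform_sqrt (n := n) ⟨0, by omega⟩).eventually_lt_const hε
  obtain ⟨b, hb, hbε⟩ := mem_nhdsGT_iff_exists_Ioo_subset.1 hev
  refine ⟨min b 1, lt_min hb one_pos, fun lam hmono hpos htwo hlt => ?_⟩
  set L := lam ⟨0, by omega⟩ with hLdef
  set l := lam ⟨n - 1, by omega⟩
  have hL0 : 0 < L := hpos.trans_le (hmono _ _ (Fin.mk_le_mk.2 (Nat.zero_le _)))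
  have hlL : l < L := (div_lt_one hL0).1 (hlt.trans_le (min_le_right _ _))
  have hint := hbε ⟨div_pos hpos hL0, hlt.trans_le (min_le_left _ _)⟩
  have := isFiniteMeasure_sphereUniform (n := n) (by omega)
  refine lt_of_le_of_lt (integral_mono_of_nonneg ?_ ?_ ?_) hint
  · refine Eventually.of_forall fun x => ?_
    simpa [rocGD_eq_shrink hpos hlL htwo] using shrink_nonneg _ _
  · refine Integrable.of_bound (C := 1) (Measurable.aestronglyMeasurable (by fun_prop)) ?_
    refine Eventually.of_forall fun x => ?_
    have ha := div_pos hpos hL0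
    rw [Real.norm_of_nonneg (Real.sqrt_nonneg _), Real.sqrt_le_one]
    exact div_le_one_of_le₀ (le_add_of_nonneg_right (sq_nonneg _)) (by positivity)
  · refine Eventually.of_forall fun x => ?_
    have hx : ∑ i, (x : EuclideanSpace ℝ (Fin n)) i ^ 2 = 1 := by
      rw [← EuclideanSpace.real_norm_sq_eq, norm_eq_of_mem_sphere, one_pow]
    simp only [rocGD_eq_shrink hpos hlL htwo]
    exact shrink_le_of_norm_eq_one hpos hlL htwo hx hLdef.symm

end
end

section
/- Let n ≥ 3 and λ₁ > ⋯ > λₙ > 0, and suppose A = diag(λ) has an intermediate eigenvalue, i.e. there is i ∈ {2,…,n−1} with λ₁ > λ_i > λₙ. Set a = λₙ/λ₁, δ = min_{i: λ₁ > λ_i > λₙ} |λ_i − (λ₁+λₙ)/2| / ((λ₁−λₙ)/2), and B = 4(1+δ²)/(1−δ²). Then the essential infimum (with respect to the uniform measure on the unit sphere S^{n−1}) of the rate of convergence satisfies essinf_{x⁰ ∈ S^{n−1}} ρ*(x⁰,λ) = (1−a)/√((1+a)² + B·a). -/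
open MeasureTheory Filter Finset Real Metric

noncomputable section

/-- Mean of `l` under the weights `p`. -/
def wMean {ι : Type*} [Fintype ι] (l p : ι → ℝ) : ℝ := ∑ i, p i * l i

/-- Second moment of `l` about its mean under the weights `p`. -/
def wVar {ι : Type*} [Fintype ι] (l p : ι → ℝ) : ℝ := ∑ i, p i * (l i - wMean l p) ^ 2

/-- Strictly positive probability weights on a set of nodes `l` with strict maximum at `t` and
strict minimum at `b`, evolving by Akaike's transformation. -/
structure IsAkaikeOrbit {ι : Type*} [Fintype ι] (l : ι → ℝ) (t b : ι) (p : ℕ → ι → ℝ) :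
    Prop where
  lt_top : ∀ i, i ≠ t → l i < l t
  bot_lt : ∀ i, i ≠ b → l b < l i
  bot_lt_top : l b < l t
  pos : ∀ k i, 0 < p k i
  sum_eq_one : ∀ k, ∑ i, p k i = 1
  step : ∀ k i, p (k + 1) i = p k i * (l i - wMean l (p k)) ^ 2 / wVar l (p k)

namespace IsAkaikeOrbit

open scoped Topology

variable {ι : Type*} [Fintype ι] {l : ι → ℝ} {t b : ι} {p : ℕ → ι → ℝ}

/-- The monic quadratic `(l - m k) (l - m (k + 1)) - V k`, orthogonal to affine functions
under the weights `p k`. -/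
def quad (l : ι → ℝ) (p : ℕ → ι → ℝ) (k : ℕ) (x : ℝ) : ℝ :=
  (x - wMean l (p k)) * (x - wMean l (p (k + 1))) - wVar l (p k)

theorem le_top (h : IsAkaikeOrbit l t b p) (i : ι) : l i ≤ l t := by
  by_cases hi : i = t
  · rw [hi]
  · exact (h.lt_top i hi).le

theorem bot_le (h : IsAkaikeOrbit l t b p) (i : ι) : l b ≤ l i := by
  by_cases hi : i = b
  · rw [hi]
  · exact (h.bot_lt i hi).le

theorem mean_le (h : IsAkaikeOrbit l t b p) (k : ℕ) : wMean l (p k) ≤ l t := by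
  have : wMean l (p k) ≤ ∑ i, p k i * l t :=
    Finset.sum_le_sum fun i _ => mul_le_mul_of_nonneg_left (h.le_top i) (h.pos k i).le
  rwa [← Finset.sum_mul, h.sum_eq_one, one_mul] at this

theorem le_mean (h : IsAkaikeOrbit l t b p) (k : ℕ) : l b ≤ wMean l (p k) := by
  have : ∑ i, p k i * l b ≤ wMean l (p k) :=
    Finset.sum_le_sum fun i _ => mul_le_mul_of_nonneg_left (h.bot_le i) (h.pos k i).le
  rwa [← Finset.sum_mul, h.sum_eq_one, one_mul] at this

theorem sum_sub_mean (h : IsAkaikeOrbit l t b p) (k : ℕ) :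
    ∑ i, p k i * (l i - wMean l (p k)) = 0 := by
  simp only [mul_sub, Finset.sum_sub_distrib, ← Finset.sum_mul, h.sum_eq_one, one_mul]
  exact sub_self _

theorem sum_sub_sq (h : IsAkaikeOrbit l t b p) (k : ℕ) (c : ℝ) :
    ∑ i, p k i * (l i - c) ^ 2 = wVar l (p k) + (wMean l (p k) - c) ^ 2 := by
  have : ∑ i, p k i * (l i - c) ^ 2 = ∑ i, p k i * (l i - wMean l (p k)) ^ 2
      + 2 * (wMean l (p k) - c) * ∑ i, p k i * (l i - wMean l (p k))
      + (wMean l (p k) - c) ^ 2 * ∑ i, p k i := by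
    simp only [Finset.mul_sum, ← Finset.sum_add_distrib]
    exact Finset.sum_congr rfl fun i _ => by ring
  rw [this, h.sum_sub_mean, h.sum_eq_one, wVar]
  ring

theorem var_pos (h : IsAkaikeOrbit l t b p) (k : ℕ) : 0 < wVar l (p k) := by
  obtain ⟨j, hj⟩ : ∃ j, l j ≠ wMean l (p k) := by
    by_contra! hc
    exact h.bot_lt_top.ne ((hc b).trans (hc t).symm)
  exact Finset.sum_pos' (fun i _ => mul_nonneg (h.pos k i).le (sq_nonneg _))
    ⟨j, Finset.mem_univ j, mul_pos (h.pos k j) (sq_pos_iff.2 (sub_ne_zero.2 hj))⟩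

theorem var_le (h : IsAkaikeOrbit l t b p) (k : ℕ) : wVar l (p k) ≤ (l t - l b) ^ 2 := by
  have : wVar l (p k) ≤ ∑ i, p k i * (l t - l b) ^ 2 := by
    refine Finset.sum_le_sum fun i _ => mul_le_mul_of_nonneg_left ?_ (h.pos k i).le
    exact sq_le_sq' (by linarith [h.bot_le i, h.mean_le k]) (by linarith [h.le_top i, h.le_mean k])
  rwa [← Finset.sum_mul, h.sum_eq_one, one_mul] at this

theorem succ_mul_var (h : IsAkaikeOrbit l t b p) (k : ℕ) (i : ι) :
    p (k + 1) i * wVar l (p k) = p k i * (l i - wMean l (p k)) ^ 2 := by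
  rw [h.step, div_mul_cancel₀ _ (h.var_pos k).ne']

theorem sum_sub_sq_mul (h : IsAkaikeOrbit l t b p) (k : ℕ) :
    ∑ i, p k i * (l i - wMean l (p k)) ^ 2 * (l i - wMean l (p (k + 1))) = 0 := by
  simp only [← h.succ_mul_var, mul_right_comm _ (wVar l (p k))]
  rw [← Finset.sum_mul, h.sum_sub_mean, zero_mul]

theorem sum_sub_sq_mul_sq (h : IsAkaikeOrbit l t b p) (k : ℕ) :
    ∑ i, p k i * (l i - wMean l (p k)) ^ 2 * (l i - wMean l (p (k + 1))) ^ 2 =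
      wVar l (p (k + 1)) * wVar l (p k) := by
  have hstep (i : ι) : p k i * (l i - wMean l (p k)) ^ 2 * (l i - wMean l (p (k + 1))) ^ 2 =
      p (k + 1) i * (l i - wMean l (p (k + 1))) ^ 2 * wVar l (p k) := by
    rw [← h.succ_mul_var]
    ring
  rw [Finset.sum_congr rfl fun i _ => hstep i, ← Finset.sum_mul]
  rfl

theorem sum_quad (h : IsAkaikeOrbit l t b p) (k : ℕ) : ∑ i, p k i * quad l p k (l i) = 0 := by
  have : ∑ i, p k i * quad l p k (l i) = ∑ i, p k i * (l i - wMean l (p k)) ^ 2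
      + (wMean l (p k) - wMean l (p (k + 1))) * ∑ i, p k i * (l i - wMean l (p k))
      - wVar l (p k) * ∑ i, p k i := by
    simp only [Finset.mul_sum, ← Finset.sum_add_distrib, ← Finset.sum_sub_distrib]
    exact Finset.sum_congr rfl fun i _ => by rw [quad]; ring
  rw [this, h.sum_sub_mean, h.sum_eq_one, wVar]
  ring

theorem sum_sub_mul_quad (h : IsAkaikeOrbit l t b p) (k : ℕ) (c : ℝ) :
    ∑ i, p k i * (l i - c) * quad l p k (l i) = 0 := by
  have : ∑ i, p k i * (l i - c) * quad l p k (l i) =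
      ∑ i, p k i * (l i - wMean l (p k)) ^ 2 * (l i - wMean l (p (k + 1)))
      - wVar l (p k) * ∑ i, p k i * (l i - wMean l (p k))
      + (wMean l (p k) - c) * ∑ i, p k i * quad l p k (l i) := by
    simp only [Finset.mul_sum, ← Finset.sum_add_distrib, ← Finset.sum_sub_distrib]
    exact Finset.sum_congr rfl fun i _ => by rw [quad]; ring
  rw [this, h.sum_sub_sq_mul, h.sum_sub_mean, h.sum_quad]
  ring

theorem sum_quad_sq (h : IsAkaikeOrbit l t b p) (k : ℕ) :
    ∑ i, p k i * quad l p k (l i) ^ 2 =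
      wVar l (p k) * (wVar l (p (k + 1)) - wVar l (p k)) := by
  have : ∑ i, p k i * quad l p k (l i) ^ 2 =
      ∑ i, p k i * (l i - wMean l (p k)) ^ 2 * (l i - wMean l (p (k + 1))) ^ 2
      - 2 * wVar l (p k) * ∑ i, p k i * quad l p k (l i)
      - wVar l (p k) ^ 2 * ∑ i, p k i := by
    simp only [Finset.mul_sum, ← Finset.sum_sub_distrib]
    exact Finset.sum_congr rfl fun i _ => by rw [quad]; ring
  rw [this, h.sum_sub_sq_mul_sq, h.sum_quad, h.sum_eq_one]
  ring

theorem monotone_var (h : IsAkaikeOrbit l t b p) : Monotone fun k => wVar l (p k) := by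
  refine monotone_nat_of_le_succ fun k => ?_
  have h1 : 0 ≤ ∑ i, p k i * quad l p k (l i) ^ 2 :=
    Finset.sum_nonneg fun i _ => mul_nonneg (h.pos k i).le (sq_nonneg _)
  rw [h.sum_quad_sq] at h1
  linarith [nonneg_of_mul_nonneg_right h1 (h.var_pos k)]

theorem mul_quad_sq_le (h : IsAkaikeOrbit l t b p) (k : ℕ) (i : ι) :
    p k i * quad l p k (l i) ^ 2 ≤ wVar l (p k) * (wVar l (p (k + 1)) - wVar l (p k)) := by
  rw [← h.sum_quad_sq]
  exact Finset.single_le_sum (f := fun i => p k i * quad l p k (l i) ^ 2)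
    (fun i _ => mul_nonneg (h.pos k i).le (sq_nonneg _)) (Finset.mem_univ i)

theorem two_step (h : IsAkaikeOrbit l t b p) (k : ℕ) (i : ι) :
    p (k + 2) i * (wVar l (p k) * wVar l (p (k + 1))) =
      p k i * (quad l p k (l i) + wVar l (p k)) ^ 2 := by
  have h1 := h.succ_mul_var k i
  have h2 := h.succ_mul_var (k + 1) i
  calc p (k + 2) i * (wVar l (p k) * wVar l (p (k + 1)))
      = (p (k + 1 + 1) i * wVar l (p (k + 1))) * wVar l (p k) := by ring
    _ = (p (k + 1) i * wVar l (p k)) * (l i - wMean l (p (k + 1))) ^ 2 := by rw [h2]; ring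
    _ = _ := by rw [h1, quad]; ring

theorem mean_two_step (h : IsAkaikeOrbit l t b p) (k : ℕ) :
    (wMean l (p (k + 2)) - wMean l (p k)) * (wVar l (p k) * wVar l (p (k + 1))) =
      ∑ i, p k i * (l i - wMean l (p k)) * quad l p k (l i) ^ 2 := by
  have h1 : wMean l (p (k + 2)) - wMean l (p k) =
      ∑ i, p (k + 2) i * (l i - wMean l (p k)) := by
    simp only [mul_sub, Finset.sum_sub_distrib, ← Finset.sum_mul, h.sum_eq_one, one_mul]
    rfl
  have h2 : ∑ i, p (k + 2) i * (l i - wMean l (p k)) * (wVar l (p k) * wVar l (p (k + 1))) =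
      ∑ i, p k i * (l i - wMean l (p k)) * quad l p k (l i) ^ 2
      + 2 * wVar l (p k) * ∑ i, p k i * (l i - wMean l (p k)) * quad l p k (l i)
      + wVar l (p k) ^ 2 * ∑ i, p k i * (l i - wMean l (p k)) := by
    simp only [Finset.mul_sum, ← Finset.sum_add_distrib]
    refine Finset.sum_congr rfl fun i _ => ?_
    rw [mul_right_comm, h.two_step]
    ring
  rw [h1, Finset.sum_mul, h2, h.sum_sub_mul_quad, h.sum_sub_mean]
  ring

theorem abs_mean_two_step_le (h : IsAkaikeOrbit l t b p) (k : ℕ) :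
    |wMean l (p (k + 2)) - wMean l (p k)| ≤
      (l t - l b) / wVar l (p 0) * (wVar l (p (k + 1)) - wVar l (p k)) := by
  have hV := h.var_pos k
  have hV' := h.var_pos (k + 1)
  have hV0 := h.var_pos 0
  have hm : wVar l (p 0) ≤ wVar l (p (k + 1)) := h.monotone_var (Nat.zero_le _)
  have hd : 0 ≤ wVar l (p (k + 1)) - wVar l (p k) := sub_nonneg.2 (h.monotone_var k.le_succ)
  have hL := h.bot_lt_top
  have h1 : |wMean l (p (k + 2)) - wMean l (p k)| * (wVar l (p k) * wVar l (p (k + 1))) ≤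
      (l t - l b) * (wVar l (p k) * (wVar l (p (k + 1)) - wVar l (p k))) := by
    rw [← abs_of_pos (mul_pos hV hV'), ← abs_mul, h.mean_two_step, ← h.sum_quad_sq,
      Finset.mul_sum]
    refine (Finset.abs_sum_le_sum_abs _ _).trans (Finset.sum_le_sum fun i _ => ?_)
    rw [abs_mul, abs_mul, abs_of_pos (h.pos k i), abs_of_nonneg (sq_nonneg (quad l p k (l i)))]
    have : |l i - wMean l (p k)| ≤ l t - l b :=
      abs_le.2 ⟨by linarith [h.bot_le i, h.mean_le k], by linarith [h.le_top i, h.le_mean k]⟩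
    nlinarith [mul_nonneg (h.pos k i).le (sq_nonneg (quad l p k (l i)))]
  have h2 : |wMean l (p (k + 2)) - wMean l (p k)| * wVar l (p (k + 1)) ≤
      (l t - l b) * (wVar l (p (k + 1)) - wVar l (p k)) := by
    refine le_of_mul_le_mul_left ?_ hV
    linarith
  rw [div_mul_eq_mul_div, le_div_iff₀ hV0]
  exact (mul_le_mul_of_nonneg_left hm (abs_nonneg _)).trans h2

theorem tendsto_var (h : IsAkaikeOrbit l t b p) :
    Tendsto (fun k => wVar l (p k)) atTop (𝓝 (⨆ k, wVar l (p k))) :=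
  tendsto_atTop_ciSup h.monotone_var ⟨(l t - l b) ^ 2, by rintro _ ⟨k, rfl⟩; exact h.var_le k⟩

theorem var_le_iSup (h : IsAkaikeOrbit l t b p) (k : ℕ) :
    wVar l (p k) ≤ ⨆ k, wVar l (p k) :=
  h.monotone_var.ge_of_tendsto h.tendsto_var k

theorem iSup_var_pos (h : IsAkaikeOrbit l t b p) : 0 < ⨆ k, wVar l (p k) :=
  (h.var_pos 0).trans_le (h.var_le_iSup 0)

/-- A bounded sequence whose increments are dominated by those of a bounded sequence
converges. -/
theorem exists_tendsto_of_abs_sub_le {a v : ℕ → ℝ} {C A D : ℝ} (hC : 0 ≤ C)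
    (ha : ∀ k, a k ≤ A) (hv : ∀ k, v k ≤ D) {v' : ℝ} (hv' : Tendsto v atTop (𝓝 v'))
    (hav : ∀ k, |a (k + 1) - a k| ≤ C * (v (k + 1) - v k)) :
    ∃ a', Tendsto a atTop (𝓝 a') := by
  have hmono : Monotone fun k => a k + C * v k := by
    refine monotone_nat_of_le_succ fun k => ?_
    have := (abs_le.1 (hav k)).1
    linarith
  have hbdd : BddAbove (Set.range fun k => a k + C * v k) := by
    refine ⟨A + C * D, ?_⟩
    rintro _ ⟨k, rfl⟩
    exact add_le_add (ha k) (mul_le_mul_of_nonneg_left (hv k) hC)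
  have := (tendsto_atTop_ciSup hmono hbdd).sub (hv'.const_mul C)
  exact ⟨_, this.congr fun k => by ring⟩

theorem abs_mean_le (h : IsAkaikeOrbit l t b p) (k : ℕ) :
    |wMean l (p k)| ≤ |l t| + |l b| := by
  refine abs_le.2 ⟨?_, ?_⟩
  · linarith [h.le_mean k, neg_abs_le (l b), abs_nonneg (l t)]
  · linarith [h.mean_le k, le_abs_self (l t), abs_nonneg (l b)]

theorem exists_tendsto_quad (h : IsAkaikeOrbit l t b p) :
    ∃ s q : ℝ, ∀ x, Tendsto (fun k => quad l p k x) atTop (𝓝 (x ^ 2 - s * x + q)) := by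
  set L := l t - l b with hL
  set M := |l t| + |l b| with hM
  have hM0 : 0 ≤ M := by positivity
  have hC : 0 ≤ L / wVar l (p 0) := div_nonneg (sub_nonneg.2 h.bot_lt_top.le) (h.var_pos 0).le
  have hm (k : ℕ) : |wMean l (p k)| ≤ M := h.abs_mean_le k
  obtain ⟨s, hs⟩ := exists_tendsto_of_abs_sub_le (a := fun k => wMean l (p k) + wMean l (p (k + 1)))
    (A := M + M) hC (fun k => add_le_add ((le_abs_self _).trans (hm k))
      ((le_abs_self _).trans (hm _))) h.var_le_iSup h.tendsto_var (fun k => by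
        rw [show wMean l (p (k + 1)) + wMean l (p (k + 1 + 1)) -
          (wMean l (p k) + wMean l (p (k + 1))) = wMean l (p (k + 2)) - wMean l (p k) by ring]
        exact h.abs_mean_two_step_le k)
  obtain ⟨q, hq⟩ := exists_tendsto_of_abs_sub_le (a := fun k => wMean l (p k) * wMean l (p (k + 1)))
    (A := M * M) (mul_nonneg hM0 hC) (fun k => (le_abs_self _).trans (by
      rw [abs_mul]; exact mul_le_mul (hm k) (hm _) (abs_nonneg _) hM0))
      h.var_le_iSup h.tendsto_var (fun k => by
        rw [show wMean l (p (k + 1)) * wMean l (p (k + 1 + 1)) -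
          wMean l (p k) * wMean l (p (k + 1)) =
          wMean l (p (k + 1)) * (wMean l (p (k + 2)) - wMean l (p k)) by ring, abs_mul, mul_assoc M]
        exact mul_le_mul (hm _) (h.abs_mean_two_step_le k) (abs_nonneg _) hM0)
  refine ⟨s, q - ⨆ k, wVar l (p k), fun x => ?_⟩
  have := ((tendsto_const_nhds (x := x ^ 2)).sub (hs.mul_const x)).add (hq.sub h.tendsto_var)
  exact this.congr fun k => by rw [quad]; ring

theorem tendsto_weight_zero (h : IsAkaikeOrbit l t b p) {i : ι} {y : ℝ}
    (hy : Tendsto (fun k => quad l p k (l i)) atTop (𝓝 y)) (hy0 : y ≠ 0) :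
    Tendsto (fun k => p k i) atTop (𝓝 0) := by
  have hV := h.tendsto_var
  have hub := hV.mul ((hV.comp (tendsto_add_atTop_nat 1)).sub hV)
  rw [sub_self, mul_zero] at hub
  have h0 : Tendsto (fun k => p k i * quad l p k (l i) ^ 2) atTop (𝓝 0) :=
    squeeze_zero (fun k => mul_nonneg (h.pos k i).le (sq_nonneg _)) (h.mul_quad_sq_le · i) hub
  have h1 := h0.div (hy.pow 2) (pow_ne_zero 2 hy0)
  rw [zero_div] at h1
  refine h1.congr' ?_
  filter_upwards [hy.eventually_ne hy0] with k hk
  exact mul_div_cancel_right₀ _ (pow_ne_zero 2 hk)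

theorem abs_limit_quad_add_le (h : IsAkaikeOrbit l t b p) {i : ι} {y : ℝ}
    (hy : Tendsto (fun k => quad l p k (l i)) atTop (𝓝 y)) :
    |y + ⨆ k, wVar l (p k)| ≤ ⨆ k, wVar l (p k) := by
  set W := ⨆ k, wVar l (p k) with hW
  have hW0 : 0 < W := h.iSup_var_pos
  by_contra! hlt
  have hy0 : y ≠ 0 := by
    rintro rfl
    rw [zero_add, abs_of_pos hW0] at hlt
    exact lt_irrefl _ hlt
  have hp := h.tendsto_weight_zero hy hy0
  have hV := h.tendsto_var
  have hlt2 : W * W < (y + W) ^ 2 := by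
    rw [← sq, ← sq_abs (y + W)]
    exact pow_lt_pow_left₀ hlt hW0.le two_ne_zero
  have hev : ∀ᶠ k in atTop,
      wVar l (p k) * wVar l (p (k + 1)) < (quad l p k (l i) + wVar l (p k)) ^ 2 :=
    (hV.mul (hV.comp (tendsto_add_atTop_nat 1))).eventually_lt ((hy.add hV).pow 2) hlt2
  obtain ⟨K, hK⟩ := eventually_atTop.1 hev
  have hstep (k : ℕ) (hk : K ≤ k) : p k i ≤ p (k + 2) i := by
    have hVV := mul_pos (h.var_pos k) (h.var_pos (k + 1))
    refine le_of_mul_le_mul_right ?_ hVV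
    rw [h.two_step]
    exact mul_le_mul_of_nonneg_left (hK k hk).le (h.pos k i).le
  have hge (j : ℕ) : p K i ≤ p (K + 2 * j) i := by
    induction j with
    | zero => exact le_rfl
    | succ j ih => exact ih.trans (hstep _ (Nat.le_add_right _ _))
  have hsub : Tendsto (fun j => p (K + 2 * j) i) atTop (𝓝 0) :=
    hp.comp (tendsto_atTop_mono (fun j => by omega : ∀ j, j ≤ K + 2 * j) tendsto_id)
  exact absurd (ge_of_tendsto' hsub hge) (h.pos K i).not_ge

theorem limit_quad_nonpos (h : IsAkaikeOrbit l t b p) {i : ι} {y : ℝ}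
    (hy : Tendsto (fun k => quad l p k (l i)) atTop (𝓝 y)) : y ≤ 0 := by
  linarith [(abs_le.1 (h.abs_limit_quad_add_le hy)).2]

theorem le_two_mul_of_limit_quad (h : IsAkaikeOrbit l t b p) {i : ι} {y : ℝ}
    (hy : Tendsto (fun k => quad l p k (l i)) atTop (𝓝 y)) : -y ≤ 2 * ⨆ k, wVar l (p k) := by
  linarith [(abs_le.1 (h.abs_limit_quad_add_le hy)).1]

theorem not_tendsto_zero_of_forall_ne (h : IsAkaikeOrbit l t b p) (j : ι) :
    ¬ ∀ i, i ≠ j → Tendsto (fun k => p k i) atTop (𝓝 0) := by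
  intro hz
  have h1 : Tendsto (fun k => ∑ i, p k i * (l i - l j) ^ 2) atTop (𝓝 0) := by
    rw [← Finset.sum_const_zero (s := (Finset.univ : Finset ι))]
    refine tendsto_finsetSum _ fun i _ => ?_
    by_cases hi : i = j
    · simp [hi]
    · simpa using (hz i hi).mul_const ((l i - l j) ^ 2)
  refine absurd (le_of_tendsto_of_tendsto' h.tendsto_var h1 fun k => ?_) h.iSup_var_pos.not_ge
  rw [h.sum_sub_sq]
  exact le_add_of_nonneg_right (sq_nonneg _)

theorem tendsto_quad (h : IsAkaikeOrbit l t b p) (x : ℝ) :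
    Tendsto (fun k => quad l p k x) atTop (𝓝 ((x - l t) * (x - l b))) := by
  obtain ⟨s, q, hsq⟩ := h.exists_tendsto_quad
  have htb := h.bot_lt_top
  have ht := h.limit_quad_nonpos (hsq (l t))
  have hb := h.limit_quad_nonpos (hsq (l b))
  have hmid (i : ι) (hit : i ≠ t) (hib : i ≠ b) : Tendsto (fun k => p k i) atTop (𝓝 0) := by
    refine h.tendsto_weight_zero (hsq (l i)) (ne_of_lt ?_)
    have h1 := h.lt_top i hit
    have h2 := h.bot_lt i hib
    nlinarith [mul_nonneg (sub_nonneg.2 h1.le) (neg_nonneg.2 hb),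
      mul_nonneg (sub_nonneg.2 h2.le) (neg_nonneg.2 ht), mul_pos (sub_pos.2 h1) (sub_pos.2 h2),
      mul_pos (mul_pos (sub_pos.2 h1) (sub_pos.2 h2)) (sub_pos.2 htb)]
  have ht0 : l t ^ 2 - s * l t + q = 0 := by
    by_contra hne
    refine h.not_tendsto_zero_of_forall_ne b fun i hib => ?_
    by_cases hit : i = t
    · rw [hit]
      exact h.tendsto_weight_zero (hsq (l t)) hne
    · exact hmid i hit hib
  have hb0 : l b ^ 2 - s * l b + q = 0 := by
    by_contra hne
    refine h.not_tendsto_zero_of_forall_ne t fun i hit => ?_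
    by_cases hib : i = b
    · rw [hib]
      exact h.tendsto_weight_zero (hsq (l b)) hne
    · exact hmid i hit hib
  have hs : s = l t + l b := by
    have : (l t - l b) * (s - (l t + l b)) = 0 := by linear_combination hb0 - ht0
    rcases mul_eq_zero.1 this with h1 | h1 <;> linarith
  convert hsq x using 2
  subst hs
  linear_combination -hb0

/-- The limiting variance of an Akaike orbit dominates the stability threshold of every
intermediate node. -/
theorem mul_le_two_mul_iSup_var (h : IsAkaikeOrbit l t b p) (i : ι) :
    (l t - l i) * (l i - l b) ≤ 2 * ⨆ k, wVar l (p k) := by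
  linarith [h.le_two_mul_of_limit_quad (h.tendsto_quad (l i))]

theorem tendsto_weight_of_ne (h : IsAkaikeOrbit l t b p) {i : ι} (hit : i ≠ t) (hib : i ≠ b) :
    Tendsto (fun k => p k i) atTop (𝓝 0) :=
  h.tendsto_weight_zero (h.tendsto_quad (l i))
    (mul_ne_zero (sub_ne_zero.2 (h.lt_top i hit).ne) (sub_ne_zero.2 (h.bot_lt i hib).ne'))

/-- Kantorovich product of an Akaike orbit: the mean of the nodes times the mean of their
reciprocals converges. -/
theorem tendsto_mean_mul_mean_inv (h : IsAkaikeOrbit l t b p) (hb : 0 < l b) :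
    Tendsto (fun k => wMean l (p k) * ∑ i, p k i * (l i)⁻¹) atTop
      (𝓝 (1 + (⨆ k, wVar l (p k)) / (l t * l b))) := by
  have ht : 0 < l t := hb.trans h.bot_lt_top
  have hl (i : ι) : l i ≠ 0 := (hb.trans_le (h.bot_le i)).ne'
  have hvan (f : ι → ℝ) : Tendsto (fun k => ∑ i, p k i * ((l i - l t) * (l i - l b) * f i)) atTop
      (𝓝 0) := by
    rw [← Finset.sum_const_zero (s := (Finset.univ : Finset ι))]
    refine tendsto_finsetSum _ fun i _ => ?_
    by_cases hit : i = t
    · simp [hit]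
    by_cases hib : i = b
    · simp [hib]
    simpa using (h.tendsto_weight_of_ne hit hib).mul_const ((l i - l t) * (l i - l b) * f i)
  have hinv (k : ℕ) : ∑ i, p k i * ((l i - l t) * (l i - l b) * (l i)⁻¹) =
      wMean l (p k) - (l t + l b) + l t * l b * ∑ i, p k i * (l i)⁻¹ := by
    have : ∑ i, p k i * ((l i - l t) * (l i - l b) * (l i)⁻¹) =
        ∑ i, p k i * l i - (l t + l b) * ∑ i, p k i + l t * l b * ∑ i, p k i * (l i)⁻¹ := by
      simp only [Finset.mul_sum, ← Finset.sum_add_distrib, ← Finset.sum_sub_distrib]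
      refine Finset.sum_congr rfl fun i _ => ?_
      have := hl i
      field_simp
      ring
    rw [this, h.sum_eq_one, wMean, mul_one]
  have hone (k : ℕ) : ∑ i, p k i * ((l i - l t) * (l i - l b) * 1) =
      wVar l (p k) + (wMean l (p k) - l t) * (wMean l (p k) - l b) := by
    have : ∑ i, p k i * ((l i - l t) * (l i - l b) * 1) =
        ∑ i, p k i * (l i - l b) ^ 2 - (l t - l b) * ∑ i, p k i * (l i - wMean l (p k))
        - (l t - l b) * (wMean l (p k) - l b) * ∑ i, p k i := by
      simp only [Finset.mul_sum, ← Finset.sum_sub_distrib]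
      exact Finset.sum_congr rfl fun i _ => by ring
    rw [this, h.sum_eq_one, h.sum_sub_mean, h.sum_sub_sq]
    ring
  have hbd : Tendsto (fun k => wMean l (p k) * ∑ i, p k i * ((l i - l t) * (l i - l b) * (l i)⁻¹))
      atTop (𝓝 0) := by
    refine squeeze_zero_norm (fun k => ?_) (by
      simpa using ((hvan fun i => (l i)⁻¹).abs.const_mul (|l t| + |l b|)))
    rw [Real.norm_eq_abs, abs_mul]
    exact mul_le_mul_of_nonneg_right (h.abs_mean_le k) (abs_nonneg _)
  have hlim := (((hbd.sub (hvan fun _ => 1)).add h.tendsto_var).div_const (l t * l b)).const_add 1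
  simp only [sub_zero, zero_add] at hlim
  refine hlim.congr fun k => ?_
  rw [hone, hinv]
  field_simp
  ring

/-- Mass of the weights `p` on the intermediate nodes, the node `l i` being counted with the
factor `(l t - l i) * (l i - l b)`. -/
def midMass (l : ι → ℝ) (t b : ι) (p : ι → ℝ) : ℝ := ∑ i, p i * ((l t - l i) * (l i - l b))

theorem mul_sub_nonneg (h : IsAkaikeOrbit l t b p) (i : ι) : 0 ≤ (l t - l i) * (l i - l b) :=
  mul_nonneg (sub_nonneg.2 (h.le_top i)) (sub_nonneg.2 (h.bot_le i))

theorem midMass_nonneg (h : IsAkaikeOrbit l t b p) (k : ℕ) : 0 ≤ midMass l t b (p k) :=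
  Finset.sum_nonneg fun i _ => mul_nonneg (h.pos k i).le (h.mul_sub_nonneg i)

theorem abs_quad_le (h : IsAkaikeOrbit l t b p) (k : ℕ) (i : ι) :
    |quad l p k (l i)| ≤ 2 * (l t - l b) ^ 2 := by
  have h1 (j : ℕ) : |l i - wMean l (p j)| ≤ l t - l b :=
    abs_le.2 ⟨by linarith [h.bot_le i, h.mean_le j], by linarith [h.le_top i, h.le_mean j]⟩
  have h2 : |(l i - wMean l (p k)) * (l i - wMean l (p (k + 1)))| ≤ (l t - l b) ^ 2 := by
    rw [abs_mul, sq]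
    exact mul_le_mul (h1 k) (h1 _) (abs_nonneg _) (sub_nonneg.2 h.bot_lt_top.le)
  have h3 := abs_le.1 h2
  rw [quad]
  exact abs_le.2 ⟨by linarith [h.var_le k], by linarith [h.var_pos k, sq_nonneg (l t - l b)]⟩

section Stability

variable {v η : ℝ}

/-- Bounds for an endpoint `e ∈ {t, b}`, where `c` is the opposite endpoint. -/
theorem endpoint_bounds (h : IsAkaikeOrbit l t b p) (hη : 0 < η)
    (hmid : ∀ i, i ≠ t → i ≠ b → 2 * η ≤ (l t - l i) * (l i - l b)) (k : ℕ) {e c : ι}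
    (hec : (e = t ∧ c = b) ∨ (e = b ∧ c = t)) :
    p k e * |quad l p k (l e)| ≤ (l t - l b) ^ 2 / η * midMass l t b (p k) ∧
      wVar l (p k) ≤ (l t - l b) ^ 2 * (p k e + midMass l t b (p k) / (2 * η)) := by
  classical
  set L := l t - l b with hL
  have hL0 : 0 < L := sub_pos.2 h.bot_lt_top
  have habs (i : ι) : |l i - l c| ≤ L := by
    rcases hec with ⟨-, rfl⟩ | ⟨-, rfl⟩ <;>
    exact abs_le.2 ⟨by linarith [h.bot_le i, h.le_top i], by linarith [h.le_top i, h.bot_le i]⟩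
  have hendL : |l e - l c| = L := by
    rcases hec with ⟨rfl, rfl⟩ | ⟨rfl, rfl⟩
    · exact abs_of_pos hL0
    · rw [abs_sub_comm]
      exact abs_of_pos hL0
  have hcase (i : ι) (hi : i ≠ e) (hc : i ≠ c) : 1 ≤ (l t - l i) * (l i - l b) / (2 * η) := by
    rw [le_div_iff₀ (by positivity), one_mul]
    rcases hec with ⟨rfl, rfl⟩ | ⟨rfl, rfl⟩
    · exact hmid i hi hc
    · exact hmid i hc hi
  have hX (i : ι) : 0 ≤ (l t - l i) * (l i - l b) / (2 * η) :=
    div_nonneg (h.mul_sub_nonneg i) (by positivity)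
  constructor
  · have h0 := h.sum_sub_mul_quad k (l c)
    rw [← Finset.add_sum_erase _ _ (Finset.mem_univ e)] at h0
    have h1 : p k e * |quad l p k (l e)| * L =
        |∑ i ∈ Finset.univ.erase e, p k i * (l i - l c) * quad l p k (l i)| := by
      rw [← abs_neg (∑ i ∈ Finset.univ.erase e, _), ← eq_neg_of_add_eq_zero_left h0, abs_mul,
        abs_mul, hendL, abs_of_pos (h.pos k e)]
      ring
    have h2 : |∑ i ∈ Finset.univ.erase e, p k i * (l i - l c) * quad l p k (l i)| ≤
        ∑ i, L ^ 3 / η * (p k i * ((l t - l i) * (l i - l b))) := by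
      refine (Finset.abs_sum_le_sum_abs _ _).trans ?_
      refine (Finset.sum_le_sum fun i hi => ?_).trans (Finset.sum_le_sum_of_subset_of_nonneg
        (Finset.erase_subset _ _) fun i _ _ => by
          have := h.mul_sub_nonneg i
          have := (h.pos k i).le
          positivity)
      by_cases hc : i = c
      · rw [hc, sub_self, mul_zero, zero_mul, abs_zero]
        have := h.mul_sub_nonneg c
        have := (h.pos k c).le
        positivity
      rw [abs_mul, abs_mul, abs_of_pos (h.pos k i), mul_assoc]
      have h3 : |l i - l c| * |quad l p k (l i)| ≤ L * (2 * L ^ 2) :=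
        mul_le_mul (habs i) (h.abs_quad_le k i) (abs_nonneg _) hL0.le
      have h4 := hcase i (Finset.ne_of_mem_erase hi) hc
      calc p k i * (|l i - l c| * |quad l p k (l i)|)
          ≤ p k i * (L * (2 * L ^ 2) * ((l t - l i) * (l i - l b) / (2 * η))) := by
            refine mul_le_mul_of_nonneg_left (h3.trans ?_) (h.pos k i).le
            exact le_mul_of_one_le_right (by positivity) h4
        _ = _ := by field_simp
    rw [← h1, ← Finset.mul_sum] at h2
    refine le_of_mul_le_mul_right (h2.trans_eq ?_) hL0
    rw [midMass]
    ring
  · have h1 : wVar l (p k) ≤ ∑ i, p k i * (l i - l c) ^ 2 := by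
      rw [h.sum_sub_sq]
      exact le_add_of_nonneg_right (sq_nonneg _)
    have h2 : ∑ i, p k i * (l i - l c) ^ 2 ≤ ∑ i, ((if i = e then L ^ 2 * p k e else 0) +
        L ^ 2 / (2 * η) * (p k i * ((l t - l i) * (l i - l b)))) := by
      refine Finset.sum_le_sum fun i _ => ?_
      have hpi := (h.pos k i).le
      have hsq : (l i - l c) ^ 2 ≤ L ^ 2 := by
        rw [← sq_abs]
        exact pow_le_pow_left₀ (abs_nonneg _) (habs i) 2
      have hx := h.mul_sub_nonneg i
      have hnn : 0 ≤ L ^ 2 / (2 * η) * (p k i * ((l t - l i) * (l i - l b))) := by positivity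
      split_ifs with hie
      · subst hie
        have := mul_le_mul_of_nonneg_left hsq hpi
        linarith
      by_cases hc : i = c
      · rw [hc] at hnn ⊢
        rw [sub_self]
        linarith
      have h4 := hcase i hie hc
      calc p k i * (l i - l c) ^ 2
          ≤ p k i * (L ^ 2 * ((l t - l i) * (l i - l b) / (2 * η))) := by
            refine mul_le_mul_of_nonneg_left (hsq.trans ?_) hpi
            exact le_mul_of_one_le_right (by positivity) h4
        _ = _ := by ring
    rw [Finset.sum_add_distrib, Finset.sum_ite_eq' Finset.univ e, if_pos (Finset.mem_univ e),
      ← Finset.mul_sum] at h2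
    refine (h1.trans h2).trans_eq ?_
    rw [midMass]
    ring

theorem var_succ_sub_le (h : IsAkaikeOrbit l t b p) (hη : 0 < η) (hv0 : 0 < v)
    (hv : v ≤ wVar l (p 0))
    (hmid : ∀ i, i ≠ t → i ≠ b → 2 * η ≤ (l t - l i) * (l i - l b)) (k : ℕ) :
    wVar l (p (k + 1)) - wVar l (p k) ≤
      6 * (l t - l b) ^ 4 / (η * v) * midMass l t b (p k) := by
  classical
  set L := l t - l b with hL
  have hL0 : 0 < L := sub_pos.2 h.bot_lt_top
  have hvk : v ≤ wVar l (p k) := hv.trans (h.monotone_var k.zero_le)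
  have hd : 0 ≤ wVar l (p (k + 1)) - wVar l (p k) := sub_nonneg.2 (h.monotone_var k.le_succ)
  have hend {e c : ι} (hec : (e = t ∧ c = b) ∨ (e = b ∧ c = t)) :
      p k e * quad l p k (l e) ^ 2 ≤ 2 * L ^ 4 / η * midMass l t b (p k) := by
    have h1 := (h.endpoint_bounds hη hmid k hec).1
    calc p k e * quad l p k (l e) ^ 2 = p k e * |quad l p k (l e)| * |quad l p k (l e)| := by
          rw [← sq_abs]; ring
      _ ≤ (L ^ 2 / η * midMass l t b (p k)) * (2 * L ^ 2) :=
          mul_le_mul h1 (h.abs_quad_le k e) (abs_nonneg _)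
            (mul_nonneg (by positivity) (h.midMass_nonneg k))
      _ = _ := by ring
  have hsum : ∑ i, p k i * quad l p k (l i) ^ 2 ≤
      ∑ i, ((if i = t then p k t * quad l p k (l t) ^ 2 else 0) +
        (if i = b then p k b * quad l p k (l b) ^ 2 else 0) +
        2 * L ^ 4 / η * (p k i * ((l t - l i) * (l i - l b)))) := by
    refine Finset.sum_le_sum fun i _ => ?_
    have hpi := (h.pos k i).le
    have hpb := (h.pos k b).le
    have hx := h.mul_sub_nonneg i
    have hnn : 0 ≤ 2 * L ^ 4 / η * (p k i * ((l t - l i) * (l i - l b))) := by positivity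
    by_cases hit : i = t
    · rw [if_pos hit, ← hit]
      have : 0 ≤ if i = b then p k b * quad l p k (l b) ^ 2 else 0 := by split_ifs <;> positivity
      rw [← hit] at hnn
      linarith
    by_cases hib : i = b
    · rw [if_neg hit, if_pos hib, ← hib]
      rw [← hib] at hnn
      linarith
    rw [if_neg hit, if_neg hib, zero_add, zero_add]
    have h4 : 1 ≤ (l t - l i) * (l i - l b) / (2 * η) := by
      rw [le_div_iff₀ (by positivity), one_mul]
      exact hmid i hit hib
    have hsq : quad l p k (l i) ^ 2 ≤ (2 * L ^ 2) ^ 2 := by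
      rw [← sq_abs]
      exact pow_le_pow_left₀ (abs_nonneg _) (h.abs_quad_le k i) 2
    calc p k i * quad l p k (l i) ^ 2
        ≤ p k i * ((2 * L ^ 2) ^ 2 * ((l t - l i) * (l i - l b) / (2 * η))) := by
          refine mul_le_mul_of_nonneg_left (hsq.trans ?_) hpi
          exact le_mul_of_one_le_right (by positivity) h4
      _ = _ := by ring
  rw [Finset.sum_add_distrib, Finset.sum_add_distrib, Finset.sum_ite_eq' Finset.univ t,
    Finset.sum_ite_eq' Finset.univ b, if_pos (Finset.mem_univ t), if_pos (Finset.mem_univ b),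
    ← Finset.mul_sum, h.sum_quad_sq] at hsum
  have h1 := hend (Or.inl ⟨rfl, rfl⟩)
  have h2 := hend (Or.inr ⟨rfl, rfl⟩)
  have h3 := mul_le_mul_of_nonneg_right hvk hd
  rw [show 6 * L ^ 4 / (η * v) * midMass l t b (p k) = 6 * L ^ 4 / η * midMass l t b (p k) / v by
    field_simp, le_div_iff₀ hv0]
  calc (wVar l (p (k + 1)) - wVar l (p k)) * v
      ≤ 2 * L ^ 4 / η * midMass l t b (p k) + 2 * L ^ 4 / η * midMass l t b (p k) +
        2 * L ^ 4 / η * midMass l t b (p k) := by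
        have h5 : ∑ i, p k i * ((l t - l i) * (l i - l b)) = midMass l t b (p k) := rfl
        rw [h5] at hsum
        linarith
    _ = _ := by ring

theorem midMass_succ_le (h : IsAkaikeOrbit l t b p) (hv0 : 0 < v) (hv : v ≤ wVar l (p 0)) (k : ℕ) :
    midMass l t b (p (k + 1)) ≤ (l t - l b) ^ 2 / v * midMass l t b (p k) := by
  rw [midMass, midMass, Finset.mul_sum]
  refine Finset.sum_le_sum fun i _ => ?_
  rw [← mul_assoc (_ / _)]
  refine mul_le_mul_of_nonneg_right ?_ (h.mul_sub_nonneg i)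
  have hvk : v ≤ wVar l (p k) := hv.trans (h.monotone_var k.zero_le)
  have hsq : (l i - wMean l (p k)) ^ 2 ≤ (l t - l b) ^ 2 :=
    sq_le_sq' (by linarith [h.bot_le i, h.mean_le k]) (by linarith [h.le_top i, h.le_mean k])
  rw [h.step, mul_comm (_ / _), mul_div_assoc]
  exact mul_le_mul_of_nonneg_left (div_le_div₀ (sq_nonneg _) hsq hv0 hvk) (h.pos k i).le

theorem midMass_two_step_le (h : IsAkaikeOrbit l t b p) (hη : 0 < η) (hv0 : 0 < v)
    (hv : v ≤ wVar l (p 0))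
    (hmid : ∀ i, i ≠ t → i ≠ b → 2 * η ≤ (l t - l i) * (l i - l b))
    (hmid' : ∀ i, i ≠ t → i ≠ b → (l t - l i) * (l i - l b) ≤ 2 * v - 2 * η) (k : ℕ)
    (hs : (l t - l b) ^ 2 * midMass l t b (p k) ≤ η * v)
    (hs' : 2 * (l t - l b) ^ 4 * midMass l t b (p k) ≤ η ^ 2 * v) :
    midMass l t b (p (k + 2)) ≤ (1 - η / (l t - l b) ^ 2) * midMass l t b (p k) := by
  set L := l t - l b with hL
  set S := midMass l t b (p k) with hS
  have hL0 : 0 < L := sub_pos.2 h.bot_lt_top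
  have hVk := h.var_pos k
  have hVk' := h.var_pos (k + 1)
  have hvk : v ≤ wVar l (p k) := hv.trans (h.monotone_var k.zero_le)
  have hVV : wVar l (p k) ≤ wVar l (p (k + 1)) := h.monotone_var k.le_succ
  have hend {e c : ι} (hec : (e = t ∧ c = b) ∨ (e = b ∧ c = t)) : |quad l p k (l e)| ≤ η := by
    obtain ⟨h1, h2⟩ := h.endpoint_bounds hη hmid k hec
    have h3 : v / (2 * L ^ 2) ≤ p k e := by
      rw [div_le_iff₀ (by positivity)]
      have : L ^ 2 * (S / (2 * η)) ≤ v / 2 := by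
        rw [← mul_div_assoc, div_le_iff₀ (by positivity)]
        linarith
      linarith
    have h4 := (mul_le_mul_of_nonneg_right h3 (abs_nonneg (quad l p k (l e)))).trans h1
    rw [div_mul_eq_mul_div, div_le_iff₀ (by positivity)] at h4
    have h5 : L ^ 2 / η * S * (2 * L ^ 2) ≤ v * η := by
      rw [show L ^ 2 / η * S * (2 * L ^ 2) = 2 * L ^ 4 * S / η by ring, div_le_iff₀ hη]
      linarith
    exact le_of_mul_le_mul_left (h4.trans h5) hv0
  have ht := abs_le.1 (hend (Or.inl ⟨rfl, rfl⟩))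
  have hb := abs_le.1 (hend (Or.inr ⟨rfl, rfl⟩))
  rw [hS, midMass, midMass, Finset.mul_sum]
  refine Finset.sum_le_sum fun i _ => ?_
  by_cases hit : i = t
  · simp [hit]
  by_cases hib : i = b
  · simp [hib]
  rw [← mul_assoc (1 - _)]
  refine mul_le_mul_of_nonneg_right ?_ (h.mul_sub_nonneg i)
  have hX := hmid i hit hib
  have hX' := hmid' i hit hib
  have hinterp : L * (quad l p k (l i) + (l t - l i) * (l i - l b)) =
      (l i - l b) * quad l p k (l t) + (l t - l i) * quad l p k (l b) := by
    rw [quad, quad, quad, hL]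
    ring
  have hlt := sub_nonneg.2 (h.le_top i)
  have hlb := sub_nonneg.2 (h.bot_le i)
  have hR : |quad l p k (l i) + (l t - l i) * (l i - l b)| ≤ η := by
    refine abs_le.2 ⟨le_of_mul_le_mul_left ?_ hL0, le_of_mul_le_mul_left ?_ hL0⟩
    · rw [hinterp]
      have := mul_le_mul_of_nonneg_left ht.1 hlb
      have := mul_le_mul_of_nonneg_left hb.1 hlt
      rw [hL]
      linarith
    · rw [hinterp]
      have := mul_le_mul_of_nonneg_left ht.2 hlb
      have := mul_le_mul_of_nonneg_left hb.2 hlt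
      rw [hL]
      linarith
  have hR' := abs_le.1 hR
  have hVη : 0 ≤ wVar l (p k) - η := by linarith
  have hQ : (quad l p k (l i) + wVar l (p k)) ^ 2 ≤ (wVar l (p k) - η) ^ 2 :=
    sq_le_sq' (by linarith) (by linarith)
  have hθ : wVar l (p k) - η ≤ (1 - η / L ^ 2) * wVar l (p k) := by
    have : η / L ^ 2 * wVar l (p k) ≤ η := by
      rw [div_mul_eq_mul_div, div_le_iff₀ (by positivity)]
      exact mul_le_mul_of_nonneg_left (h.var_le k) hη.le
    linarith
  have hmain : (quad l p k (l i) + wVar l (p k)) ^ 2 ≤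
      (1 - η / L ^ 2) * (wVar l (p k) * wVar l (p (k + 1))) := by
    calc (quad l p k (l i) + wVar l (p k)) ^ 2
        ≤ (wVar l (p k) - η) * (wVar l (p k) - η) := by rw [← sq]; exact hQ
      _ ≤ ((1 - η / L ^ 2) * wVar l (p k)) * wVar l (p (k + 1)) :=
          mul_le_mul hθ (by linarith) hVη (hVη.trans hθ)
      _ = _ := by ring
  refine le_of_mul_le_mul_right ?_ (mul_pos hVk hVk')
  rw [h.two_step]
  calc p k i * (quad l p k (l i) + wVar l (p k)) ^ 2
      ≤ p k i * ((1 - η / L ^ 2) * (wVar l (p k) * wVar l (p (k + 1)))) :=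
        mul_le_mul_of_nonneg_left hmain (h.pos k i).le
    _ = _ := by ring

/-- An Akaike orbit starting with small mass on intermediate nodes and with variance at least `v`,
where `v` exceeds the stability threshold, has its limiting variance close to its initial
variance. -/
theorem exists_iSup_var_le (hlt : l b < l t) (hη : 0 < η) (hv0 : 0 < v)
    (hmid : ∀ i, i ≠ t → i ≠ b → 2 * η ≤ (l t - l i) * (l i - l b))
    (hmid' : ∀ i, i ≠ t → i ≠ b → (l t - l i) * (l i - l b) ≤ 2 * v - 2 * η)
    {ε : ℝ} (hε : 0 < ε) :
    ∃ s > 0, ∀ p : ℕ → ι → ℝ, IsAkaikeOrbit l t b p → v ≤ wVar l (p 0) →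
      midMass l t b (p 0) < s → ⨆ k, wVar l (p k) ≤ wVar l (p 0) + ε := by
  set L := l t - l b with hL
  have hL0 : 0 < L := sub_pos.2 hlt
  set K := 6 * L ^ 4 / (η * v) * (L ^ 2 / η) with hK
  have hK0 : 0 < K := by positivity
  set s₁ := min (η * v / L ^ 2) (η ^ 2 * v / (2 * L ^ 4)) with hs₁
  have hs₁0 : 0 < s₁ := lt_min (by positivity) (by positivity)
  set D := 1 + L ^ 2 / v with hD
  have hD1 : 1 ≤ D := le_add_of_nonneg_right (by positivity)
  have hD0 : 0 < D := by linarith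
  refine ⟨min (s₁ / D) (ε / (K * D)), lt_min (by positivity) (by positivity),
    fun p h hv hS => ?_⟩
  have hS0 := h.midMass_nonneg 0
  have hS1 : midMass l t b (p 0) + midMass l t b (p 1) ≤ D * midMass l t b (p 0) := by
    have := h.midMass_succ_le hv0 hv 0
    rw [hD]
    linarith
  have hSs : D * midMass l t b (p 0) ≤ s₁ := by
    have := (lt_div_iff₀ hD0).1 (hS.trans_le (min_le_left _ _))
    linarith
  have hSε : K * (D * midMass l t b (p 0)) ≤ ε := by
    have := (lt_div_iff₀ (by positivity)).1 (hS.trans_le (min_le_right _ _))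
    linarith
  have hcond (k : ℕ) (hk : midMass l t b (p k) ≤ s₁) :
      midMass l t b (p (k + 2)) ≤ (1 - η / L ^ 2) * midMass l t b (p k) := by
    refine h.midMass_two_step_le hη hv0 hv hmid hmid' k ?_ ?_
    · have := (le_div_iff₀ (by positivity)).1 (hk.trans (min_le_left _ _))
      linarith
    · have := (le_div_iff₀ (by positivity)).1 (hk.trans (min_le_right _ _))
      linarith
  have hsmall (k : ℕ) : midMass l t b (p k) ≤ s₁ ∧ midMass l t b (p (k + 1)) ≤ s₁ := by
    induction k with
    | zero =>
      have := h.midMass_nonneg 1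
      exact ⟨by linarith, by rw [zero_add]; linarith⟩
    | succ k ih =>
      refine ⟨ih.2, (hcond k ih.1).trans ?_⟩
      have : 0 ≤ η / L ^ 2 * midMass l t b (p k) :=
        mul_nonneg (by positivity) (h.midMass_nonneg k)
      linarith [ih.1]
  have hanti : Antitone fun k =>
      wVar l (p k) + K * (midMass l t b (p k) + midMass l t b (p (k + 1))) := by
    refine antitone_nat_of_succ_le fun k => ?_
    have h1 := mul_le_mul_of_nonneg_left (hcond k (hsmall k).1) hK0.le
    have h2 := h.var_succ_sub_le hη hv0 hv hmid k
    have h3 : K * (η / L ^ 2) = 6 * L ^ 4 / (η * v) := by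
      rw [hK]
      field_simp
    rw [← hL, ← h3] at h2
    linarith
  refine ciSup_le fun k => ?_
  have h1 := hanti k.zero_le
  have h2 : 0 ≤ K * (midMass l t b (p k) + midMass l t b (p (k + 1))) :=
    mul_nonneg hK0.le (add_nonneg (h.midMass_nonneg k) (h.midMass_nonneg _))
  have h3 := mul_le_mul_of_nonneg_left hS1 hK0.le
  simp only [zero_add] at h1
  linarith

end Stability

end IsAkaikeOrbit

section GradientDescent

open scoped Topology

variable {n : ℕ} {lam : Fin n → ℝ}

/-- Normalized squared components of the gradient `A x`. -/
def gradWeight (lam : Fin n → ℝ) (x : Fin n → ℝ) (i : Fin n) : ℝ :=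
  lam i ^ 2 * x i ^ 2 / qform lam 2 x

theorem qform_pos (hlam : ∀ i, 0 < lam i) {x : Fin n → ℝ} (hx : x ≠ 0) (k : ℕ) :
    0 < qform lam k x := by
  obtain ⟨j, hj⟩ := Function.ne_iff.1 hx
  rw [Pi.zero_apply] at hj
  have h0 (i : Fin n) : 0 < lam i ^ k := pow_pos (hlam i) k
  exact Finset.sum_pos' (fun i _ => mul_nonneg (h0 i).le (sq_nonneg _))
    ⟨j, Finset.mem_univ j, mul_pos (h0 j) (by positivity)⟩

theorem sum_gradWeight (hlam : ∀ i, 0 < lam i) {x : Fin n → ℝ} (hx : x ≠ 0) :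
    ∑ i, gradWeight lam x i = 1 := by
  simp only [gradWeight]
  rw [← Finset.sum_div]
  exact div_self (qform_pos hlam hx 2).ne'

theorem wMean_gradWeight (lam : Fin n → ℝ) (x : Fin n → ℝ) :
    wMean lam (gradWeight lam x) = qform lam 3 x / qform lam 2 x := by
  rw [wMean, qform, Finset.sum_div]
  exact Finset.sum_congr rfl fun i _ => by rw [gradWeight]; ring

theorem sum_gradWeight_mul_inv (hlam : ∀ i, 0 < lam i) (x : Fin n → ℝ) :
    ∑ i, gradWeight lam x i * (lam i)⁻¹ = qform lam 1 x / qform lam 2 x := by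
  rw [qform, Finset.sum_div]
  refine Finset.sum_congr rfl fun i _ => ?_
  rw [gradWeight]
  have := (hlam i).ne'
  field_simp

theorem shrink_eq (hlam : ∀ i, 0 < lam i) {x : Fin n → ℝ} (hx : x ≠ 0) :
    shrink lam x = √(1 - (wMean lam (gradWeight lam x) *
      ∑ i, gradWeight lam x i * (lam i)⁻¹)⁻¹) := by
  rw [shrink, if_neg hx, wMean_gradWeight, sum_gradWeight_mul_inv hlam]
  have := (qform_pos hlam hx 2).ne'
  congr 2
  field_simp

theorem GD_apply (hlam : ∀ i, 0 < lam i) {x : Fin n → ℝ} (hx : x ≠ 0) (i : Fin n) :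
    GD lam x i = x i * (wMean lam (gradWeight lam x) - lam i) / wMean lam (gradWeight lam x) := by
  rw [GD, if_neg hx, wMean_gradWeight]
  have := (qform_pos hlam hx 2).ne'
  have := (qform_pos hlam hx 3).ne'
  field_simp

theorem gradWeight_GD (hlam : ∀ i, 0 < lam i) {x : Fin n → ℝ} (hx : x ≠ 0) (i : Fin n) :
    gradWeight lam (GD lam x) i = gradWeight lam x i * (lam i - wMean lam (gradWeight lam x)) ^ 2 /
      wVar lam (gradWeight lam x) := by
  set m := wMean lam (gradWeight lam x) with hm
  have h2 := qform_pos hlam hx 2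
  have hm0 : m ≠ 0 := by
    rw [hm, wMean_gradWeight]
    exact (div_pos (qform_pos hlam hx 3) h2).ne'
  have hterm (j : Fin n) : lam j ^ 2 * GD lam x j ^ 2 =
      gradWeight lam x j * (lam j - m) ^ 2 * (qform lam 2 x / m ^ 2) := by
    rw [GD_apply hlam hx, ← hm, gradWeight]
    field_simp
    ring
  have hq : qform lam 2 (GD lam x) = wVar lam (gradWeight lam x) * (qform lam 2 x / m ^ 2) := by
    rw [qform, Finset.sum_congr rfl fun j _ => hterm j, ← Finset.sum_mul]
    rfl
  rw [gradWeight, hterm, hq]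
  exact mul_div_mul_right _ _ (div_ne_zero h2.ne' (pow_ne_zero 2 hm0))

/-- The normalized gradients along a gradient descent run with nonvanishing coordinates form an
Akaike orbit. -/
theorem isAkaikeOrbit_gradWeight {t b : Fin n} (hlam : ∀ i, 0 < lam i)
    (ht : ∀ i, i ≠ t → lam i < lam t) (hb : ∀ i, i ≠ b → lam b < lam i) (hbt : lam b < lam t)
    {x : Fin n → ℝ} (hx : ∀ k i, (GD lam)^[k] x i ≠ 0) :
    IsAkaikeOrbit lam t b fun k => gradWeight lam ((GD lam)^[k] x) := by
  have hne (k : ℕ) : (GD lam)^[k] x ≠ 0 := fun h => hx k t (congr_fun h t)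
  refine ⟨ht, hb, hbt, fun k i => ?_, fun k => sum_gradWeight hlam (hne k), fun k i => ?_⟩
  · have := hx k i
    have := hlam i
    exact div_pos (by positivity) (qform_pos hlam (hne k) 2)
  · rw [Function.iterate_succ_apply', gradWeight_GD hlam (hne k)]

theorem tendsto_geom_mean {c : ℕ → ℝ} {r : ℝ} (hc : ∀ k, 0 < c k) (hr : 0 < r)
    (h : Tendsto c atTop (𝓝 r)) :
    Tendsto (fun k : ℕ => (∏ j ∈ Finset.range k, c j) ^ ((k : ℝ)⁻¹)) atTop (𝓝 r) := by
  have h1 := (h.log hr.ne').cesaro.rexp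
  rw [Real.exp_log hr] at h1
  refine h1.congr fun k => ?_
  rw [Real.rpow_def_of_pos (Finset.prod_pos fun j _ => hc j),
    Real.log_prod fun j _ => (hc j).ne', mul_comm]

theorem wMean_mul_sum_inv_gt_one {t b : Fin n} {p : ℕ → Fin n → ℝ} (h : IsAkaikeOrbit lam t b p)
    (hlam : ∀ i, 0 < lam i) (k : ℕ) : 1 < wMean lam (p k) * ∑ i, p k i * (lam i)⁻¹ := by
  set m := wMean lam (p k) with hm
  have hm0 : 0 < m := (hlam b).trans_le (h.le_mean k)
  have h1 : ∑ i, p k i * (lam i)⁻¹ * (lam i - m) ^ 2 = m * (m * ∑ i, p k i * (lam i)⁻¹ - 1) := by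
    have : ∑ i, p k i * (lam i)⁻¹ * (lam i - m) ^ 2 =
        ∑ i, p k i * lam i - 2 * m * ∑ i, p k i + m ^ 2 * ∑ i, p k i * (lam i)⁻¹ := by
      simp only [Finset.mul_sum, ← Finset.sum_add_distrib, ← Finset.sum_sub_distrib]
      refine Finset.sum_congr rfl fun i _ => ?_
      have := (hlam i).ne'
      field_simp
      ring
    rw [this, h.sum_eq_one, ← wMean, ← hm]
    ring
  have h2 : 0 < ∑ i, p k i * (lam i)⁻¹ * (lam i - m) ^ 2 := by
    have h3 : wVar lam (p k) * (lam t)⁻¹ ≤ ∑ i, p k i * (lam i)⁻¹ * (lam i - m) ^ 2 := by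
      rw [wVar, Finset.sum_mul]
      refine Finset.sum_le_sum fun i _ => ?_
      rw [mul_right_comm]
      refine mul_le_mul_of_nonneg_right ?_ (sq_nonneg _)
      exact mul_le_mul_of_nonneg_left (inv_anti₀ (hlam i) (h.le_top i)) (h.pos k i).le
    exact (mul_pos (h.var_pos k) (inv_pos.2 (hlam t))).trans_le h3
  rw [h1] at h2
  linarith [pos_of_mul_pos_right h2 hm0.le]

/-- The rate of convergence is determined by the limiting variance of the normalized gradients. -/
theorem rocGD_eq {t b : Fin n} (hlam : ∀ i, 0 < lam i)
    (ht : ∀ i, i ≠ t → lam i < lam t) (hb : ∀ i, i ≠ b → lam b < lam i) (hbt : lam b < lam t)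
    {x : Fin n → ℝ} (hx : ∀ k i, (GD lam)^[k] x i ≠ 0) :
    rocGD lam x = √((⨆ k, wVar lam (gradWeight lam ((GD lam)^[k] x))) /
      ((⨆ k, wVar lam (gradWeight lam ((GD lam)^[k] x))) + lam t * lam b)) := by
  have h := isAkaikeOrbit_gradWeight hlam ht hb hbt hx
  have hne (k : ℕ) : (GD lam)^[k] x ≠ 0 := fun h0 => hx k t (congr_fun h0 t)
  have hW := h.iSup_var_pos
  have hlim := h.tendsto_mean_mul_mean_inv (hlam b)
  set W := ⨆ k, wVar lam (gradWeight lam ((GD lam)^[k] x))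
  have htb := mul_pos (hlam t) (hlam b)
  have hsh (k : ℕ) : 0 < shrink lam ((GD lam)^[k] x) := by
    rw [shrink_eq hlam (hne k)]
    exact Real.sqrt_pos.2 (sub_pos.2 (inv_lt_one_of_one_lt₀ (wMean_mul_sum_inv_gt_one h hlam k)))
  have hlim' : Tendsto (fun k => shrink lam ((GD lam)^[k] x)) atTop
      (𝓝 √(W / (W + lam t * lam b))) := by
    have h1 : W / (W + lam t * lam b) = 1 - (1 + W / (lam t * lam b))⁻¹ := by
      have := (add_pos hW htb).ne'
      have : 1 + W / (lam t * lam b) ≠ 0 := by positivity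
      have := (hlam t).ne'
      have := (hlam b).ne'
      field_simp
      ring
    rw [h1]
    simp only [fun k => shrink_eq hlam (hne k)]
    exact ((hlim.inv₀ (by positivity)).const_sub 1).sqrt
  exact (tendsto_geom_mean hsh (Real.sqrt_pos.2 (div_pos hW (add_pos hW htb))) hlim').limsup_eq

end GradientDescent

section NullSets

open scoped Pointwise

theorem addHaar_zeros_eq_zero {E : Type*} [NormedAddCommGroup E] [NormedSpace ℝ E]
    [FiniteDimensional ℝ E] [MeasurableSpace E] [BorelSpace E] (μ : Measure E)
    [μ.IsAddHaarMeasure] {f : E → ℝ} (hf : AnalyticOnNhd ℝ f Set.univ) {x₀ : E}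
    (hx₀ : f x₀ ≠ 0) : μ {x | f x = 0} = 0 := by
  have hcont : Continuous f := continuousOn_univ.1 hf.continuousOn
  have hline (y : E) : ∀ᵐ s : ℝ, f (x₀ + s • y) ≠ 0 := by
    have han : AnalyticOnNhd ℝ (fun s : ℝ => f (x₀ + s • y)) Set.univ := fun s _ =>
      (hf (x₀ + s • y) (Set.mem_univ _)).comp_of_eq (by fun_prop) rfl
    have h1 := han.preimage_zero_mem_codiscrete (x := 0) (by simpa using hx₀)
    have h2 := ae_restrict_le_codiscreteWithin (μ := (volume : Measure ℝ)) MeasurableSet.univ h1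
    rw [Measure.restrict_univ] at h2
    exact h2
  have hmeas : MeasurableSet {z : E × ℝ | f (x₀ + z.2 • z.1) ≠ 0} :=
    (isOpen_ne_fun (by fun_prop) continuous_const).measurableSet
  have h3 := (Measure.ae_ae_comm (μ := μ) (ν := (volume : Measure ℝ))
    (p := fun y s => f (x₀ + s • y) ≠ 0) hmeas).1 (Eventually.of_forall hline)
  obtain ⟨s, hs, hs0⟩ := (h3.and (Measure.ae_ne volume (0 : ℝ))).exists
  have h4 : μ ((s • ·) ⁻¹' ((x₀ + ·) ⁻¹' {x | f x = 0})) = 0 := by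
    simpa [ae_iff] using hs
  rw [Measure.addHaar_preimage_smul μ hs0, measure_preimage_add] at h4
  refine (mul_eq_zero.1 h4).resolve_left ?_
  rw [ENNReal.ofReal_eq_zero, not_le, abs_pos]
  exact inv_ne_zero (pow_ne_zero _ hs0)

variable {n : ℕ} {lam : Fin n → ℝ}

/-- Gradient descent with denominators cleared. -/
def gdPoly (lam : Fin n → ℝ) (x : Fin n → ℝ) : Fin n → ℝ :=
  fun i => x i * (qform lam 3 x - lam i * qform lam 2 x)

theorem qform_smul (lam : Fin n → ℝ) (k : ℕ) (c : ℝ) (x : Fin n → ℝ) :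
    qform lam k (c • x) = c ^ 2 * qform lam k x := by
  rw [qform, qform, Finset.mul_sum]
  exact Finset.sum_congr rfl fun i _ => by rw [Pi.smul_apply, smul_eq_mul]; ring

theorem gdPoly_smul (lam : Fin n → ℝ) (c : ℝ) (x : Fin n → ℝ) :
    gdPoly lam (c • x) = c ^ 3 • gdPoly lam x := by
  ext i
  simp only [gdPoly, qform_smul, Pi.smul_apply, smul_eq_mul]
  ring

theorem iterate_gdPoly_smul (lam : Fin n → ℝ) {c : ℝ} (hc : c ≠ 0) (x : Fin n → ℝ) (k : ℕ) :
    ∃ d : ℝ, d ≠ 0 ∧ (gdPoly lam)^[k] (c • x) = d • (gdPoly lam)^[k] x := by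
  induction k with
  | zero => exact ⟨c, hc, rfl⟩
  | succ k ih =>
    obtain ⟨d, hd, h⟩ := ih
    exact ⟨d ^ 3, pow_ne_zero 3 hd, by
      rw [Function.iterate_succ_apply', h, gdPoly_smul, Function.iterate_succ_apply']⟩

theorem iterate_GD_apply_ne_zero (hlam : ∀ i, 0 < lam i) {x : Fin n → ℝ}
    (hx : ∀ k i, (gdPoly lam)^[k] x i ≠ 0) (k : ℕ) (i : Fin n) : (GD lam)^[k] x i ≠ 0 := by
  have hk (k : ℕ) : ∃ c : ℝ, (gdPoly lam)^[k] x = c • (GD lam)^[k] x := by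
    induction k with
    | zero => exact ⟨1, (one_smul ℝ x).symm⟩
    | succ k ih =>
      obtain ⟨c, h⟩ := ih
      have hne : (GD lam)^[k] x ≠ 0 := fun h0 => hx k i (by rw [h, h0, smul_zero]; rfl)
      have h3 := (qform_pos hlam hne 3).ne'
      refine ⟨c ^ 3 * qform lam 3 ((GD lam)^[k] x), ?_⟩
      rw [Function.iterate_succ_apply', h, gdPoly_smul, Function.iterate_succ_apply', mul_smul]
      congr 1
      ext j
      rw [gdPoly, GD, if_neg hne, Pi.smul_apply, smul_eq_mul]
      field_simp
  obtain ⟨c, h⟩ := hk k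
  intro h0
  apply hx k i
  rw [h, Pi.smul_apply, h0, smul_zero]

theorem exists_iterate_gdPoly_ne_zero (hlam : ∀ i, 0 < lam i) (hinj : Function.Injective lam)
    {i j : Fin n} (hij : i ≠ j) (k : ℕ) : ∃ x : Fin n → ℝ, (gdPoly lam)^[k] x i ≠ 0 := by
  suffices ∃ x : Fin n → ℝ, (gdPoly lam)^[k] x i ≠ 0 ∧ (gdPoly lam)^[k] x j ≠ 0 ∧
      ∀ l, l ≠ i → l ≠ j → (gdPoly lam)^[k] x l = 0 by
    obtain ⟨x, hx, -⟩ := this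
    exact ⟨x, hx⟩
  refine ⟨fun l => if l = i ∨ l = j then 1 else 0, ?_⟩
  induction k with
  | zero => exact ⟨by simp, by simp, fun l hi hj => by simp [hi, hj]⟩
  | succ k ih =>
    rw [Function.iterate_succ_apply']
    set y := (gdPoly lam)^[k] fun l => if l = i ∨ l = j then 1 else 0
    obtain ⟨hi, hj, hl⟩ := ih
    have hq (m : ℕ) : qform lam m y = lam i ^ m * y i ^ 2 + lam j ^ m * y j ^ 2 :=
      Finset.sum_eq_add i j hij (fun l _ hlij => by rw [hl l hlij.1 hlij.2]; ring)
        (by simp) (by simp)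
    have h1 := (hlam i).ne'
    have h2 := (hlam j).ne'
    have h3 : lam i - lam j ≠ 0 := sub_ne_zero.2 (hinj.ne hij)
    refine ⟨?_, ?_, fun l hli hlj => by rw [gdPoly, hl l hli hlj, zero_mul]⟩
    · have : gdPoly lam y i = -(y i * (lam j ^ 2 * y j ^ 2 * (lam i - lam j))) := by
        rw [gdPoly, hq, hq]
        ring
      rw [this]
      exact neg_ne_zero.2 (by positivity)
    · have : gdPoly lam y j = y j * (lam i ^ 2 * y i ^ 2 * (lam i - lam j)) := by
        rw [gdPoly, hq, hq]
        ring
      rw [this]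
      positivity

theorem analyticOnNhd_iterate_gdPoly (lam : Fin n → ℝ) (k : ℕ) (i : Fin n) :
    AnalyticOnNhd ℝ (fun x : EuclideanSpace ℝ (Fin n) => (gdPoly lam)^[k] x i) Set.univ := by
  induction k generalizing i with
  | zero => exact fun x _ => (EuclideanSpace.proj (𝕜 := ℝ) i).analyticAt x
  | succ k ih =>
    simp only [Function.iterate_succ_apply', gdPoly, qform]
    intro x _
    have h1 (j : Fin n) := ih j x (Set.mem_univ x)
    have h2 (m : ℕ) : AnalyticAt ℝ (fun x : EuclideanSpace ℝ (Fin n) =>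
        ∑ j, lam j ^ m * (gdPoly lam)^[k] x j ^ 2) x :=
      Finset.analyticAt_fun_sum _ fun j _ => analyticAt_const.mul ((h1 j).pow 2)
    exact (h1 i).mul ((h2 3).sub (analyticAt_const.mul (h2 2)))

theorem ae_iterate_GD_ne_zero (hlam : ∀ i, 0 < lam i) (hinj : Function.Injective lam)
    (hn : 2 ≤ n) : ∀ᵐ x : sphere (0 : EuclideanSpace ℝ (Fin n)) 1 ∂sphereUniform n,
      ∀ k i, (GD lam)^[k] (x : EuclideanSpace ℝ (Fin n)) i ≠ 0 := by
  refine Measure.ae_smul_measure ?_ _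
  suffices ∀ᵐ x : sphere (0 : EuclideanSpace ℝ (Fin n)) 1 ∂(volume.toSphere),
      ∀ k i, (gdPoly lam)^[k] (x : EuclideanSpace ℝ (Fin n)) i ≠ 0 by
    filter_upwards [this] with x hx
    exact iterate_GD_apply_ne_zero hlam hx
  refine ae_all_iff.2 fun k => ae_all_iff.2 fun i => ?_
  have : Nontrivial (Fin n) := Fin.nontrivial_iff_two_le.2 hn
  obtain ⟨j, hj⟩ := exists_ne i
  obtain ⟨x₀, hx₀⟩ := exists_iterate_gdPoly_ne_zero hlam hinj hj.symm k
  have hnull := addHaar_zeros_eq_zero (volume : Measure (EuclideanSpace ℝ (Fin n)))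
    (analyticOnNhd_iterate_gdPoly lam k i) (x₀ := WithLp.toLp 2 x₀) hx₀
  have hcont : Continuous fun x : EuclideanSpace ℝ (Fin n) => (gdPoly lam)^[k] x i :=
    continuousOn_univ.1 (analyticOnNhd_iterate_gdPoly lam k i).continuousOn
  have hmeas : MeasurableSet {x : sphere (0 : EuclideanSpace ℝ (Fin n)) 1 |
      (gdPoly lam)^[k] (x : EuclideanSpace ℝ (Fin n)) i = 0} :=
    (isClosed_eq (hcont.comp continuous_subtype_val) continuous_const).measurableSet
  rw [ae_iff]
  simp only [not_not]
  rw [Measure.toSphere_apply' _ hmeas]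
  refine mul_eq_zero_of_right _ (measure_mono_null ?_ hnull)
  rintro _ ⟨c, hc, _, ⟨x, hx, rfl⟩, rfl⟩
  obtain ⟨d, -, hd⟩ := iterate_gdPoly_smul lam hc.1.ne' (x : EuclideanSpace ℝ (Fin n)) k
  have hx' : (gdPoly lam)^[k] (x : EuclideanSpace ℝ (Fin n)) i = 0 := hx
  change (gdPoly lam)^[k] (c • ((x : EuclideanSpace ℝ (Fin n)) : Fin n → ℝ)) i = 0
  rw [hd, Pi.smul_apply, hx', smul_zero]

end NullSets

section EssentialInfimum

open scoped Topology
open IsAkaikeOrbit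

variable {n : ℕ} {lam : Fin n → ℝ} {t b : Fin n}

theorem continuous_gradWeight (hlam : ∀ i, 0 < lam i) (i : Fin n) :
    Continuous fun x : sphere (0 : EuclideanSpace ℝ (Fin n)) 1 =>
      gradWeight lam (x : EuclideanSpace ℝ (Fin n)) i := by
  have hc (j : Fin n) : Continuous fun x : sphere (0 : EuclideanSpace ℝ (Fin n)) 1 =>
      (x : EuclideanSpace ℝ (Fin n)) j := by fun_prop
  have hq : Continuous fun x : sphere (0 : EuclideanSpace ℝ (Fin n)) 1 =>
      qform lam 2 (x : EuclideanSpace ℝ (Fin n)) :=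
    continuous_finsetSum _ fun j _ => continuous_const.mul ((hc j).pow 2)
  refine (continuous_const.mul ((hc i).pow 2)).div hq fun x => (qform_pos hlam ?_ 2).ne'
  exact fun h => ne_zero_of_mem_unit_sphere x ((WithLp.ofLp_eq_zero 2).1 h)

theorem continuous_wVar_gradWeight (hlam : ∀ i, 0 < lam i) :
    Continuous fun x : sphere (0 : EuclideanSpace ℝ (Fin n)) 1 =>
      wVar lam (gradWeight lam (x : EuclideanSpace ℝ (Fin n))) := by
  have hg := continuous_gradWeight hlam
  unfold wVar wMean
  fun_prop

theorem continuous_midMass_gradWeight (hlam : ∀ i, 0 < lam i) (t b : Fin n) :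
    Continuous fun x : sphere (0 : EuclideanSpace ℝ (Fin n)) 1 =>
      midMass lam t b (gradWeight lam (x : EuclideanSpace ℝ (Fin n))) := by
  have hg := continuous_gradWeight hlam
  unfold midMass
  fun_prop

theorem gradWeight_smul (lam : Fin n → ℝ) {c : ℝ} (hc : c ≠ 0) (x : Fin n → ℝ) :
    gradWeight lam (c • x) = gradWeight lam x := by
  ext i
  rw [gradWeight, gradWeight, qform_smul, Pi.smul_apply, smul_eq_mul, mul_pow, mul_left_comm]
  exact mul_div_mul_left _ _ (pow_ne_zero 2 hc)

theorem exists_sphere_gradWeight_eq (hlam : ∀ i, 0 < lam i) {w : Fin n → ℝ} (hw : ∀ i, 0 ≤ w i)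
    (hsum : ∑ i, w i = 1) :
    ∃ x : sphere (0 : EuclideanSpace ℝ (Fin n)) 1,
      gradWeight lam (x : EuclideanSpace ℝ (Fin n)) = w := by
  set y : EuclideanSpace ℝ (Fin n) := WithLp.toLp 2 fun i => √(w i) / lam i with hy
  have hterm (i : Fin n) : lam i ^ 2 * y i ^ 2 = w i := by
    have := (hlam i).ne'
    change lam i ^ 2 * (√(w i) / lam i) ^ 2 = w i
    rw [div_pow, Real.sq_sqrt (hw i)]
    field_simp
  have hq : qform lam 2 y = 1 := by
    rw [qform, Finset.sum_congr rfl fun i _ => hterm i, hsum]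
  have hy0 : y ≠ 0 := by
    intro h0
    rw [h0] at hq
    simp [qform] at hq
  have hny : ‖y‖⁻¹ ≠ 0 := inv_ne_zero (norm_ne_zero_iff.2 hy0)
  refine ⟨⟨‖y‖⁻¹ • y, ?_⟩, ?_⟩
  · rw [mem_sphere_zero_iff_norm, norm_smul, norm_inv, norm_norm,
      inv_mul_cancel₀ (norm_ne_zero_iff.2 hy0)]
  · change gradWeight lam (‖y‖⁻¹ • (y : Fin n → ℝ)) = w
    rw [gradWeight_smul lam hny]
    ext i
    rw [gradWeight, hterm, hq, div_one]

theorem exists_sphere_wVar_eq (hlam : ∀ i, 0 < lam i) (hbt : lam b < lam t) {y : ℝ}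
    (hy0 : 0 < y) (hy : 4 * y < (lam t - lam b) ^ 2) :
    ∃ x : sphere (0 : EuclideanSpace ℝ (Fin n)) 1,
      wVar lam (gradWeight lam (x : EuclideanSpace ℝ (Fin n))) = y ∧
      midMass lam t b (gradWeight lam (x : EuclideanSpace ℝ (Fin n))) = 0 := by
  have hL := sub_pos.2 hbt
  set L := lam t - lam b with hLdef
  set r := √(1 - 4 * y / L ^ 2) with hr
  have hrsq : r ^ 2 = 1 - 4 * y / L ^ 2 :=
    Real.sq_sqrt (sub_nonneg.2 ((div_le_one (by positivity)).2 hy.le))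
  have hr0 : 0 ≤ r := Real.sqrt_nonneg _
  have hr1 : r ≤ 1 := by
    have : 0 < 4 * y / L ^ 2 := by positivity
    nlinarith
  have htb : t ≠ b := by
    rintro rfl
    exact lt_irrefl _ hbt
  set w : Fin n → ℝ := fun i => (if i = t then (1 + r) / 2 else 0) +
    (if i = b then (1 - r) / 2 else 0) with hw
  have hws (f : Fin n → ℝ) : ∑ i, w i * f i = (1 + r) / 2 * f t + (1 - r) / 2 * f b := by
    simp only [hw, add_mul, ite_mul, zero_mul, Finset.sum_add_distrib, Finset.sum_ite_eq',
      Finset.mem_univ, if_true]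
  obtain ⟨x, hx⟩ := exists_sphere_gradWeight_eq hlam (w := w)
    (fun i => add_nonneg (by split_ifs <;> linarith) (by split_ifs <;> linarith)) (by
      have := hws fun _ => 1
      simp only [mul_one] at this
      rw [this]
      ring)
  refine ⟨x, ?_, ?_⟩
  · rw [hx, wVar, hws, wMean, hws]
    have h1 : r ^ 2 * L ^ 2 = L ^ 2 - 4 * y := by
      rw [hrsq]
      field_simp
    rw [hLdef] at h1
    linear_combination -(1 / 4) * h1
  · rw [hx, midMass, hws]
    ring

theorem sphereUniform_ne_zero_of_isOpen {U : Set (sphere (0 : EuclideanSpace ℝ (Fin n)) 1)}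
    (hU : IsOpen U) (hne : U.Nonempty) : sphereUniform n U ≠ 0 := by
  rw [sphereUniform, Measure.smul_apply, smul_eq_mul]
  exact mul_ne_zero (ENNReal.inv_ne_zero.2 (measure_ne_top _ _)) (hU.measure_ne_zero _ hne)

/-- The essential infimum of the rate of convergence is the rate attached to the smallest limiting
variance `τ` compatible with stability. -/
theorem essInf_rocGD_eq (hlam : ∀ i, 0 < lam i) (hinj : Function.Injective lam)
    (ht : ∀ i, i ≠ t → lam i < lam t) (hb : ∀ i, i ≠ b → lam b < lam i) (hbt : lam b < lam t)
    {τ : ℝ} (hτ0 : 0 < τ) (hτL : 4 * τ < (lam t - lam b) ^ 2)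
    (hτ : ∀ i, i ≠ t → i ≠ b → (lam t - lam i) * (lam i - lam b) ≤ 2 * τ)
    (hex : ∃ i, (lam t - lam i) * (lam i - lam b) = 2 * τ) :
    essInf (fun x : sphere (0 : EuclideanSpace ℝ (Fin n)) 1 =>
        rocGD lam (x : EuclideanSpace ℝ (Fin n))) (sphereUniform n)
      = √(τ / (τ + lam t * lam b)) := by
  have hn : 2 ≤ n := by
    have h1 := t.2
    have h2 := b.2
    have h3 : (t : ℕ) ≠ b := fun h => hbt.ne' (congrArg lam (Fin.ext h))
    omega
  have htb := mul_pos (hlam t) (hlam b)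
  have hmono {W W' : ℝ} (hW : 0 < W) (hWW : W ≤ W') :
      √(W / (W + lam t * lam b)) ≤ √(W' / (W' + lam t * lam b)) := by
    refine Real.sqrt_le_sqrt ?_
    rw [div_le_div_iff₀ (by positivity) (by linarith)]
    nlinarith
  have hgood := ae_iterate_GD_ne_zero hlam hinj hn
  rw [essInf_eq_sSup]
  refine IsGreatest.csSup_eq ⟨?_, fun a ha => ?_⟩
  · have h1 : ∀ᵐ x : sphere (0 : EuclideanSpace ℝ (Fin n)) 1 ∂sphereUniform n,
        √(τ / (τ + lam t * lam b)) ≤ rocGD lam (x : EuclideanSpace ℝ (Fin n)) := by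
      filter_upwards [hgood] with x hx
      rw [rocGD_eq hlam ht hb hbt hx]
      obtain ⟨i, hi⟩ := hex
      have h2 := (isAkaikeOrbit_gradWeight hlam ht hb hbt hx).mul_le_two_mul_iSup_var i
      exact hmono hτ0 (by linarith)
    simpa only [Set.mem_ofPred_eq, ae_iff, not_le] using h1
  have ha' : ∀ᵐ x : sphere (0 : EuclideanSpace ℝ (Fin n)) 1 ∂sphereUniform n,
      a ≤ rocGD lam (x : EuclideanSpace ℝ (Fin n)) := by
    simpa only [Set.mem_ofPred_eq, ae_iff, not_le] using ha
  obtain ⟨η₀, hη₀, hmid⟩ : ∃ η₀ > 0, ∀ i, i ≠ t → i ≠ b →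
      2 * η₀ ≤ (lam t - lam i) * (lam i - lam b) := by
    have hev : ∀ᶠ η in 𝓝[>] (0 : ℝ), ∀ i, i ≠ t → i ≠ b →
        2 * η ≤ (lam t - lam i) * (lam i - lam b) := by
      refine eventually_all.2 fun i => ?_
      by_cases hi : i ≠ t ∧ i ≠ b
      · have hpos : 0 < (lam t - lam i) * (lam i - lam b) / 2 :=
          half_pos (mul_pos (sub_pos.2 (ht i hi.1)) (sub_pos.2 (hb i hi.2)))
        filter_upwards [Ioo_mem_nhdsGT hpos] with η hη _ _
        linarith [hη.2]
      · exact Eventually.of_forall fun η h1 h2 => absurd ⟨h1, h2⟩ hi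
    obtain ⟨η₀, h1, h2⟩ := (hev.and self_mem_nhdsWithin).exists
    exact ⟨η₀, h2, h1⟩
  have hbound (ε : ℝ) (hε : 0 < ε) (hεL : 4 * (τ + 2 * ε) < (lam t - lam b) ^ 2) :
      a ≤ √((τ + 4 * ε) / ((τ + 4 * ε) + lam t * lam b)) := by
    obtain ⟨s, hs, hstab⟩ := exists_iSup_var_le (l := lam) (t := t) (b := b) (v := τ + ε)
      (η := min η₀ ε) hbt (lt_min hη₀ hε) (by linarith)
      (fun i h1 h2 => by linarith [hmid i h1 h2, min_le_left η₀ ε])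
      (fun i h1 h2 => by linarith [hτ i h1 h2, min_le_right η₀ ε]) hε
    set U := {x : sphere (0 : EuclideanSpace ℝ (Fin n)) 1 |
      (τ + ε < wVar lam (gradWeight lam (x : EuclideanSpace ℝ (Fin n))) ∧
        wVar lam (gradWeight lam (x : EuclideanSpace ℝ (Fin n))) < τ + 3 * ε) ∧
      midMass lam t b (gradWeight lam (x : EuclideanSpace ℝ (Fin n))) < s}
    have hUo : IsOpen U :=
      ((isOpen_lt continuous_const (continuous_wVar_gradWeight hlam)).inter
        (isOpen_lt (continuous_wVar_gradWeight hlam) continuous_const)).inter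
        (isOpen_lt (continuous_midMass_gradWeight hlam t b) continuous_const)
    have hUne : U.Nonempty := by
      obtain ⟨x, hx1, hx2⟩ := exists_sphere_wVar_eq hlam hbt (y := τ + 2 * ε) (by linarith) hεL
      exact ⟨x, ⟨by rw [hx1]; linarith, by rw [hx1]; linarith⟩, by rw [hx2]; exact hs⟩
    have hfreq : ∃ᶠ x in ae (sphereUniform n), x ∈ U :=
      frequently_ae_iff.2 (sphereUniform_ne_zero_of_isOpen hUo hUne)
    obtain ⟨x, hxU, hx, hax⟩ := (hfreq.and_eventually (hgood.and ha')).exists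
    have horb := isAkaikeOrbit_gradWeight hlam ht hb hbt hx
    have h1 := hstab _ horb hxU.1.1.le hxU.2
    rw [rocGD_eq hlam ht hb hbt hx] at hax
    have h2 := hxU.1.2
    simp only [Function.iterate_zero, id_eq] at h1
    exact hax.trans (hmono horb.iSup_var_pos (by linarith))
  have hcont : Tendsto (fun ε : ℝ => √((τ + 4 * ε) / ((τ + 4 * ε) + lam t * lam b))) (𝓝[>] 0)
      (𝓝 √(τ / (τ + lam t * lam b))) := by
    have h1 : ContinuousAt (fun ε : ℝ => √((τ + 4 * ε) / ((τ + 4 * ε) + lam t * lam b))) 0 :=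
      (ContinuousAt.div (by fun_prop) (by fun_prop) (by
        rw [mul_zero, add_zero]
        positivity)).sqrt
    have h2 := h1.tendsto
    simp only [mul_zero, add_zero] at h2
    exact h2.mono_left nhdsWithin_le_nhds
  refine ge_of_tendsto hcont ?_
  have hpos : 0 < ((lam t - lam b) ^ 2 - 4 * τ) / 8 := by linarith
  filter_upwards [Ioo_mem_nhdsGT hpos] with ε hε
  exact hbound ε hε.1 (by linarith [hε.2])

end EssentialInfimum

/-- Theorem 2 / Akaike's bound, completed: essential infimum of the ROC
over seeds on the unit sphere. -/
theorem essInf_roc_eq (n : ℕ) (hn : 3 ≤ n) (lam : Fin n → ℝ)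
    (hord : ∀ i j : Fin n, i < j → lam j < lam i)
    (hpos : 0 < lam ⟨n - 1, by omega⟩)
    (hmid : ∃ i : Fin n, lam i < lam ⟨0, by omega⟩ ∧ lam ⟨n - 1, by omega⟩ < lam i)
    (a δ B : ℝ)
    (ha : a = lam ⟨n - 1, by omega⟩ / lam ⟨0, by omega⟩)
    (hδ : δ = sInf ((fun i : Fin n =>
        |lam i - (lam ⟨0, by omega⟩ + lam ⟨n - 1, by omega⟩) / 2| /
          ((lam ⟨0, by omega⟩ - lam ⟨n - 1, by omega⟩) / 2)) ''
        {i : Fin n | lam i < lam ⟨0, by omega⟩ ∧ lam ⟨n - 1, by omega⟩ < lam i}))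
    (hB : B = 4 * (1 + δ ^ 2) / (1 - δ ^ 2)) :
    essInf (fun x : sphere (0 : EuclideanSpace ℝ (Fin n)) 1 =>
        rocGD lam (x : EuclideanSpace ℝ (Fin n))) (sphereUniform n)
      = (1 - a) / Real.sqrt ((1 + a) ^ 2 + B * a) := by
  set t : Fin n := ⟨0, by omega⟩
  set b : Fin n := ⟨n - 1, by omega⟩
  have hanti : StrictAnti lam := fun i j hij => hord i j hij
  have ht (i : Fin n) (hi : i ≠ t) : lam i < lam t :=
    hord t i (Fin.lt_def.2 (Nat.pos_of_ne_zero fun h => hi (Fin.ext h)))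
  have hb (i : Fin n) (hi : i ≠ b) : lam b < lam i := by
    refine hord i b (Fin.lt_def.2 ?_)
    have h1 := i.2
    have h2 : (i : ℕ) ≠ n - 1 := fun h => hi (Fin.ext h)
    change (i : ℕ) < n - 1
    omega
  have hlam (i : Fin n) : 0 < lam i := by
    by_cases hi : i = b
    · rwa [hi]
    · exact hpos.trans (hb i hi)
  obtain ⟨i₀, hi₀⟩ := hmid
  have hbt : lam b < lam t := hi₀.2.trans hi₀.1
  set h := (lam t - lam b) / 2 with hh
  have hh0 : 0 < h := half_pos (sub_pos.2 hbt)
  set S := {i : Fin n | lam i < lam t ∧ lam b < lam i}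
  set d : Fin n → ℝ := fun i => |lam i - (lam t + lam b) / 2| / h with hd
  have hX (i : Fin n) : (lam t - lam i) * (lam i - lam b) = h ^ 2 * (1 - d i ^ 2) := by
    rw [hd]
    simp only [div_pow, sq_abs]
    field_simp
    rw [hh]
    ring
  have hfin : (d '' S).Finite := S.toFinite.image d
  obtain ⟨j, hjS, hj⟩ : δ ∈ d '' S := hδ ▸ Set.Nonempty.csInf_mem ⟨_, i₀, hi₀, rfl⟩ hfin
  have hδle (i : Fin n) (hi : i ∈ S) : δ ≤ d i :=
    hδ ▸ csInf_le hfin.bddBelow (Set.mem_image_of_mem d hi)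
  have hδ0 : 0 ≤ δ := by
    rw [← hj]
    positivity
  have hδ1 : 0 < 1 - δ ^ 2 := by
    have h1 := mul_pos (sub_pos.2 hjS.1) (sub_pos.2 hjS.2)
    rw [hX, hj] at h1
    exact pos_of_mul_pos_right h1 (sq_nonneg h)
  rw [essInf_rocGD_eq hlam hanti.injective ht hb hbt (τ := h ^ 2 * (1 - δ ^ 2) / 2)
    (by positivity) (by rw [hh] at hh0 ⊢; nlinarith [sq_nonneg δ, mul_pos hh0 hh0])
    (fun i hit hib => by
      have h1 := pow_le_pow_left₀ hδ0 (hδle i ⟨ht i hit, hb i hib⟩) 2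
      have h2 := mul_le_mul_of_nonneg_left h1 (sq_nonneg h)
      rw [hX]
      linarith)
    ⟨j, by rw [hX, hj]; ring⟩]
  have ht0 := hlam t
  have hb0 := hlam b
  have ha1 : 0 ≤ 1 - a := by
    rw [ha]
    exact sub_nonneg.2 ((div_le_one ht0).2 hbt.le)
  rw [← Real.sqrt_sq ha1, ← Real.sqrt_div (sq_nonneg _)]
  congr 1
  have hB0 : 0 < B := by
    rw [hB]
    positivity
  have ha0 : 0 < a := by
    rw [ha]
    positivity
  rw [div_eq_div_iff (by positivity) (by positivity)]
  have e1 : lam b = a * lam t := by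
    rw [ha]
    field_simp
  have e2 : B * (1 - δ ^ 2) = 4 * (1 + δ ^ 2) := by
    rw [hB]
    field_simp
  rw [hh, e1]
  linear_combination (lam t) ^ 2 * (1 - a) ^ 2 * a / 8 * e2

end
end

section
/- For every λ = (λ₁,…,λₙ) with λ₁ ≥ ⋯ ≥ λₙ > 0, there exists an initial vector x⁰ ∈ ℝⁿ, x⁰ ≠ 0, such that equality ‖GD^k(x⁰)‖_A = ((λ₁−λₙ)/(λ₁+λₙ))^k · ‖x⁰‖_A holds for every iteration k ≥ 0; e.g. any x⁰ with |x⁰₁| = (λₙ/λ₁)|x⁰ₙ|, x⁰ₙ ≠ 0, and x⁰_i = 0 for 2 ≤ i ≤ n−1 works. -/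
open MeasureTheory Filter Finset Real Metric

noncomputable section

/-- The `A`-norm `‖x‖_A = √(xᵀAx)` for `A = diag lam`. -/
def Anorm {n : ℕ} (lam : Fin n → ℝ) (x : Fin n → ℝ) : ℝ :=
  Real.sqrt (qform lam 1 x)

/-- Vectors supported on the coordinates `i`, `j` with `|λᵢ xᵢ| = |λⱼ xⱼ|`. -/
def IsBalanced {n : ℕ} (lam : Fin n → ℝ) (i j : Fin n) (x : Fin n → ℝ) : Prop :=
  (lam i * x i) ^ 2 = (lam j * x j) ^ 2 ∧ ∀ l, l ≠ i → l ≠ j → x l = 0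

theorem qform_eq_add_of_support {n : ℕ} {lam x : Fin n → ℝ} {i j : Fin n} (hij : i ≠ j)
    (hx : ∀ l, l ≠ i → l ≠ j → x l = 0) (k : ℕ) :
    qform lam k x = lam i ^ k * x i ^ 2 + lam j ^ k * x j ^ 2 :=
  Fintype.sum_eq_add i j hij fun l hl => by simp [hx l hl.1 hl.2]

theorem GD_apply_of_isBalanced {n : ℕ} {lam x : Fin n → ℝ} {i j : Fin n} (hij : i ≠ j)
    (hi : 0 < lam i) (hj : 0 < lam j) (hx : IsBalanced lam i j x) (l : Fin n) :
    GD lam x l = x l - 2 / (lam i + lam j) * (lam l * x l) := by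
  obtain ⟨hbal, hsupp⟩ := hx
  by_cases h0 : x = 0
  · simp [GD, h0]
  have hxj : x j ≠ 0 := by
    intro hxj
    have hxi : x i = 0 := by simpa [hxj, hi.ne'] using hbal
    refine h0 (funext fun l => ?_)
    by_cases hli : l = i
    · rw [hli, hxi, Pi.zero_apply]
    by_cases hlj : l = j
    · rw [hlj, hxj, Pi.zero_apply]
    exact hsupp l hli hlj
  have h2 : qform lam 2 x = 2 * (lam j * x j) ^ 2 := by
    rw [qform_eq_add_of_support hij hsupp]
    linear_combination hbal
  have h3 : qform lam 3 x = (lam i + lam j) * (lam j * x j) ^ 2 := by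
    rw [qform_eq_add_of_support hij hsupp]
    linear_combination lam i * hbal
  have hsum : lam i + lam j ≠ 0 := (add_pos hi hj).ne'
  have hne : (lam j * x j) ^ 2 ≠ 0 := pow_ne_zero 2 (mul_ne_zero hj.ne' hxj)
  simp only [GD, if_neg h0, h2, h3, mul_div_mul_right _ _ hne]

theorem GD_sq_of_isBalanced {n : ℕ} {lam x : Fin n → ℝ} {i j : Fin n} (hij : i ≠ j)
    (hi : 0 < lam i) (hj : 0 < lam j) (hx : IsBalanced lam i j x) (l : Fin n) :
    GD lam x l ^ 2 = ((lam i - lam j) / (lam i + lam j)) ^ 2 * x l ^ 2 := by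
  have hsum : lam i + lam j ≠ 0 := (add_pos hi hj).ne'
  rw [GD_apply_of_isBalanced hij hi hj hx]
  by_cases hli : l = i
  · subst hli
    field_simp
    ring
  by_cases hlj : l = j
  · subst hlj
    field_simp
    ring
  simp [hx.2 l hli hlj]

theorem IsBalanced.GD {n : ℕ} {lam x : Fin n → ℝ} {i j : Fin n} (hij : i ≠ j)
    (hi : 0 < lam i) (hj : 0 < lam j) (hx : IsBalanced lam i j x) :
    IsBalanced lam i j (GD lam x) := by
  refine ⟨?_, fun l hli hlj => ?_⟩
  · rw [mul_pow, mul_pow, GD_sq_of_isBalanced hij hi hj hx, GD_sq_of_isBalanced hij hi hj hx]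
    linear_combination ((lam i - lam j) / (lam i + lam j)) ^ 2 * hx.1
  · simp [GD_apply_of_isBalanced hij hi hj hx, hx.2 l hli hlj]

theorem Anorm_GD_of_isBalanced {n : ℕ} {lam x : Fin n → ℝ} {i j : Fin n} (hij : i ≠ j)
    (hi : 0 < lam i) (hj : 0 < lam j) (hle : lam j ≤ lam i) (hx : IsBalanced lam i j x) :
    Anorm lam (GD lam x) = (lam i - lam j) / (lam i + lam j) * Anorm lam x := by
  have hrate : 0 ≤ (lam i - lam j) / (lam i + lam j) :=
    div_nonneg (sub_nonneg.2 hle) (add_pos hi hj).le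
  have hq : qform lam 1 (GD lam x) =
      ((lam i - lam j) / (lam i + lam j)) ^ 2 * qform lam 1 x := by
    simp only [qform, GD_sq_of_isBalanced hij hi hj hx, Finset.mul_sum]
    exact Finset.sum_congr rfl fun l _ => by ring
  rw [Anorm, Anorm, hq, Real.sqrt_mul (sq_nonneg _), Real.sqrt_sq hrate]

theorem Anorm_iterate_GD_of_isBalanced {n : ℕ} {lam x : Fin n → ℝ} {i j : Fin n} (hij : i ≠ j)
    (hi : 0 < lam i) (hj : 0 < lam j) (hle : lam j ≤ lam i) (hx : IsBalanced lam i j x) (k : ℕ) :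
    Anorm lam ((GD lam)^[k] x) = ((lam i - lam j) / (lam i + lam j)) ^ k * Anorm lam x := by
  induction k generalizing x with
  | zero => simp
  | succ k ih =>
    rw [Function.iterate_succ_apply, ih (hx.GD hij hi hj),
      Anorm_GD_of_isBalanced hij hi hj hle hx, pow_succ, mul_assoc]

/-- the worst-case bound is attained: any seed with
`|x⁰₁| = (λₙ/λ₁)|x⁰ₙ|`, `x⁰ₙ ≠ 0` and vanishing middle coordinates achieves equality
at every iteration; in particular such a seed exists. -/
theorem exists_seed_worst_case (n : ℕ) (hn : 2 ≤ n) (lam : Fin n → ℝ)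
    (hord : ∀ i j : Fin n, i ≤ j → lam j ≤ lam i)
    (hpos : 0 < lam ⟨n - 1, by omega⟩) :
    (∀ x0 : Fin n → ℝ,
      |x0 ⟨0, by omega⟩| = lam ⟨n - 1, by omega⟩ / lam ⟨0, by omega⟩ * |x0 ⟨n - 1, by omega⟩| →
      x0 ⟨n - 1, by omega⟩ ≠ 0 →
      (∀ i : Fin n, 0 < (i : ℕ) → (i : ℕ) < n - 1 → x0 i = 0) →
      x0 ≠ 0 ∧ ∀ k : ℕ,
        Anorm lam ((GD lam)^[k] x0) =
          ((lam ⟨0, by omega⟩ - lam ⟨n - 1, by omega⟩) /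
            (lam ⟨0, by omega⟩ + lam ⟨n - 1, by omega⟩)) ^ k * Anorm lam x0) ∧
    ∃ x0 : Fin n → ℝ, x0 ≠ 0 ∧ ∀ k : ℕ,
      Anorm lam ((GD lam)^[k] x0) =
        ((lam ⟨0, by omega⟩ - lam ⟨n - 1, by omega⟩) /
          (lam ⟨0, by omega⟩ + lam ⟨n - 1, by omega⟩)) ^ k * Anorm lam x0 := by
  have hij : (⟨0, by omega⟩ : Fin n) ≠ ⟨n - 1, by omega⟩ := by
    simp only [ne_eq, Fin.mk.injEq]
    omega
  have hle := hord ⟨0, by omega⟩ ⟨n - 1, by omega⟩ (Nat.zero_le _)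
  have hpos' := hpos.trans_le hle
  refine (fun hseed => ⟨hseed, ?_⟩) fun x0 habs hne hmid => ⟨fun h => hne (by simp [h]),
    Anorm_iterate_GD_of_isBalanced hij hpos' hpos hle ⟨?_, fun l hl0 hln => ?_⟩⟩
  · set x : Fin n → ℝ := fun l => if l = ⟨0, by omega⟩ then
      lam ⟨n - 1, by omega⟩ / lam ⟨0, by omega⟩ else if l = ⟨n - 1, by omega⟩ then 1 else 0 with hx
    refine ⟨x, hseed x ?_ ?_ fun l hl0 hln => ?_⟩
    · simp [hx, hij.symm, abs_of_pos (div_pos hpos hpos')]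
    · simp [hx, hij.symm]
    · simp [hx, Fin.ext_iff, hl0.ne', hln.ne]
  · rw [sq_eq_sq_iff_abs_eq_abs, abs_mul, abs_mul, habs, abs_of_pos hpos', abs_of_pos hpos]
    field_simp
  · rw [ne_eq, Fin.ext_iff] at hl0 hln
    exact hmid l (Nat.pos_of_ne_zero hl0) (by have := l.isLt; dsimp only at hln; omega)

end
end

section
/- Let λ₁ > ⋯ > λₙ > 0, let p ∈ Δₙ be a probability vector that is not a vertex of the simplex (i.e. p ≠ e_i for all i), and define x ∈ ℝⁿ by x_j = √(p_j)/λ_j. Then x is not an eigenvector of A = diag(λ), GD(x) ≠ 0, and σ(GD(x)) = T(p), where σ(y)_i = λ_i² y_i² / Σ_j λ_j² y_j². That is, Akaike's map T is the representation of exact line search gradient descent in the coordinates σ. -/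
open MeasureTheory Filter Finset Real Metric

noncomputable section

/-- `λ̄(p) = ∑ⱼ λⱼ pⱼ`. -/
def lamMean {n : ℕ} (lam p : Fin n → ℝ) : ℝ := ∑ j, lam j * p j

/-- Akaike's map `T(p)ᵢ = pᵢ(λ̄(p) − λᵢ)² / ∑ⱼ pⱼ(λ̄(p) − λⱼ)²`. -/
def Tmap {n : ℕ} (lam : Fin n → ℝ) (p : Fin n → ℝ) : Fin n → ℝ := fun i =>
  p i * (lamMean lam p - lam i) ^ 2 / ∑ j, p j * (lamMean lam p - lam j) ^ 2

/-- Membership in `dom(T) = Δₙ ∖ {e₁,…,eₙ}`: a probability vector that is not a vertex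
of the simplex. -/
def memDomT {n : ℕ} (p : Fin n → ℝ) : Prop :=
  p ∈ stdSimplex ℝ (Fin n) ∧ ∀ i : Fin n, p ≠ Pi.single i 1

/-- Akaike's coordinates `σ(y)ᵢ = λᵢ² yᵢ² / ∑ⱼ λⱼ² yⱼ²`. -/
def sigmaMap {n : ℕ} (lam : Fin n → ℝ) (y : Fin n → ℝ) : Fin n → ℝ := fun i =>
  lam i ^ 2 * y i ^ 2 / ∑ j, lam j ^ 2 * y j ^ 2

lemma exists_pos_and_ne_of_memDomT {n : ℕ} {lam p : Fin n → ℝ}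
    (hlam : Function.Injective lam) (hp : memDomT p) (c : ℝ) :
    ∃ i, 0 < p i ∧ lam i ≠ c := by
  obtain ⟨⟨hnonneg, hsum⟩, hvertex⟩ := hp
  by_contra! h
  obtain ⟨i, -, hi⟩ := Finset.exists_ne_zero_of_sum_ne_zero (hsum.trans_ne one_ne_zero)
  have hzero : ∀ j, j ≠ i → p j = 0 := fun j hji => by
    by_contra hj
    exact hji (hlam ((h j ((hnonneg j).lt_of_ne' hj)).trans
      (h i ((hnonneg i).lt_of_ne' hi)).symm))
  have hone : p i = 1 := by
    rw [← hsum, Finset.sum_eq_single i (fun j _ => hzero j) (by simp)]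
  refine hvertex i (funext fun j => ?_)
  by_cases hji : j = i
  · subst hji
    simpa using hone
  · simpa [hji] using hzero j hji

lemma lamMean_pos {n : ℕ} {lam p : Fin n → ℝ} (hlam : ∀ i, 0 < lam i)
    (hp : p ∈ stdSimplex ℝ (Fin n)) : 0 < lamMean lam p := by
  obtain ⟨i, -, hi⟩ := Finset.exists_ne_zero_of_sum_ne_zero (hp.2.trans_ne one_ne_zero)
  exact Finset.sum_pos' (fun j _ => mul_nonneg (hlam j).le (hp.1 j))
    ⟨i, Finset.mem_univ i, mul_pos (hlam i) ((hp.1 i).lt_of_ne' hi)⟩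

lemma mul_GD_sqrt_div {n : ℕ} {lam p : Fin n → ℝ} (hlam : ∀ i, 0 < lam i)
    (hp : p ∈ stdSimplex ℝ (Fin n)) (i : Fin n) :
    lam i * GD lam (fun j => √(p j) / lam j) i =
      √(p i) * (lamMean lam p - lam i) / lamMean lam p := by
  have hmean := lamMean_pos hlam hp
  have hq2 : qform lam 2 (fun j => √(p j) / lam j) = 1 := by
    rw [← hp.2]
    refine Finset.sum_congr rfl fun j _ => ?_
    have := (hlam j).ne'
    rw [div_pow, Real.sq_sqrt (hp.1 j)]
    field_simp
  have hq3 : qform lam 3 (fun j => √(p j) / lam j) = lamMean lam p := by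
    refine Finset.sum_congr rfl fun j _ => ?_
    have := (hlam j).ne'
    rw [div_pow, Real.sq_sqrt (hp.1 j)]
    field_simp
  have hx : (fun j => √(p j) / lam j) ≠ 0 := fun h => by
    rw [h] at hq2
    simp [qform] at hq2
  have := (hlam i).ne'
  rw [GD, if_neg hx, hq2, hq3]
  field_simp

/-- Akaike's map `T` is the representation of exact line search gradient
descent in the coordinates `σ`: for a non-vertex `p ∈ Δₙ` and `x_j = √(p_j)/λ_j`,
`x` is not an eigenvector of `A = diag λ`, `GD(x) ≠ 0`, and `σ(GD(x)) = T(p)`. -/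
theorem sigma_GD_eq_Tmap (n : ℕ) (hn : 2 ≤ n) (lam : Fin n → ℝ)
    (hord : ∀ i j : Fin n, i < j → lam j < lam i)
    (hpos : 0 < lam ⟨n - 1, by omega⟩)
    (p : Fin n → ℝ) (hp : memDomT p)
    (x : Fin n → ℝ) (hx : x = fun j => Real.sqrt (p j) / lam j) :
    (¬ ∃ μ : ℝ, (fun i => lam i * x i) = fun i => μ * x i) ∧
    GD lam x ≠ 0 ∧
    sigmaMap lam (GD lam x) = Tmap lam p := by
  have hanti : StrictAnti lam := fun i j hij => hord i j hij
  have hlam : ∀ i, 0 < lam i := fun i =>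
    hpos.trans_le (hanti.antitone (Fin.le_def.2 (Nat.le_sub_one_of_lt i.isLt)))
  have hmean := lamMean_pos hlam hp.1
  subst hx
  refine ⟨?_, ?_, ?_⟩
  · rintro ⟨μ, hμ⟩
    obtain ⟨i, hi, hne⟩ := exists_pos_and_ne_of_memDomT hanti.injective hp μ
    exact hne (mul_right_cancel₀ (div_pos (Real.sqrt_pos.2 hi) (hlam i)).ne' (congrFun hμ i))
  · intro h
    obtain ⟨i, hi, hne⟩ :=
      exists_pos_and_ne_of_memDomT hanti.injective hp (lamMean lam p)
    have hGD := mul_GD_sqrt_div hlam hp.1 i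
    rw [h, Pi.zero_apply, mul_zero] at hGD
    exact div_ne_zero (mul_ne_zero (Real.sqrt_pos.2 hi).ne' (sub_ne_zero.2 hne.symm))
      hmean.ne' hGD.symm
  · have hsq : ∀ i, lam i ^ 2 * GD lam (fun j => √(p j) / lam j) i ^ 2 =
        p i * (lamMean lam p - lam i) ^ 2 / lamMean lam p ^ 2 := fun i => by
      rw [← mul_pow, mul_GD_sqrt_div hlam hp.1, div_pow, mul_pow, Real.sq_sqrt (hp.1.1 i)]
    funext i
    simp only [sigmaMap, Tmap, hsq]
    rw [← Finset.sum_div, div_div_div_cancel_right₀ (pow_ne_zero 2 hmean.ne')]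

end
end

section
/- Akaike's map T depends only on the normalized intermediate eigenvalues: if λ = (λ₁,…,λₙ) and λ' = (λ'₁,…,λ'ₙ) both satisfy λ₁ > ⋯ > λₙ > 0 and λ'₁ > ⋯ > λ'ₙ > 0, and (λ_i − λₙ)/(λ₁ − λₙ) = (λ'_i − λ'ₙ)/(λ'₁ − λ'ₙ) for every i = 2,…,n−1, then T_λ(p) = T_{λ'}(p) for every p in dom(T). -/
open MeasureTheory Filter Finset Real Metric

noncomputable section

/-- An affine change of eigenvalues acts on the mean in the same way. -/
theorem lamMean_affine {n : ℕ} (lam p : Fin n → ℝ) (a b : ℝ) (hp : ∑ i, p i = 1) :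
    lamMean (fun i => a * lam i + b) p = a * lamMean lam p + b := by
  simp only [lamMean, add_mul, Finset.sum_add_distrib, mul_assoc, ← Finset.mul_sum, hp, mul_one]

/-- Akaike's map is invariant under nonconstant affine changes of the eigenvalues. -/
theorem Tmap_affine {n : ℕ} (lam p : Fin n → ℝ) {a : ℝ} (b : ℝ) (ha : a ≠ 0)
    (hp : ∑ i, p i = 1) : Tmap (fun i => a * lam i + b) p = Tmap lam p := by
  have key (i : Fin n) : p i * (a * lamMean lam p + b - (a * lam i + b)) ^ 2 =
      a ^ 2 * (p i * (lamMean lam p - lam i) ^ 2) := by ring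
  funext i
  simp only [Tmap, lamMean_affine lam p a b hp, key, ← Finset.mul_sum]
  exact mul_div_mul_left _ _ (pow_ne_zero 2 ha)

/-- Akaike's map depends only on the normalized intermediate eigenvalues
`αᵢ = (λᵢ − λₙ)/(λ₁ − λₙ)`. -/
theorem Tmap_depends_only_on_alphas (n : ℕ) (hn : 2 ≤ n) (lam lam' : Fin n → ℝ)
    (hord : ∀ i j : Fin n, i < j → lam j < lam i)
    (hord' : ∀ i j : Fin n, i < j → lam' j < lam' i)
    (hpos : 0 < lam ⟨n - 1, by omega⟩) (hpos' : 0 < lam' ⟨n - 1, by omega⟩)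
    (hratio : ∀ i : Fin n, 0 < (i : ℕ) → (i : ℕ) < n - 1 →
      (lam i - lam ⟨n - 1, by omega⟩) / (lam ⟨0, by omega⟩ - lam ⟨n - 1, by omega⟩) =
        (lam' i - lam' ⟨n - 1, by omega⟩) / (lam' ⟨0, by omega⟩ - lam' ⟨n - 1, by omega⟩)) :
    ∀ p : Fin n → ℝ, memDomT p → Tmap lam p = Tmap lam' p := by
  intro p hp
  set z : Fin n := ⟨0, by omega⟩
  set l : Fin n := ⟨n - 1, by omega⟩
  have hzl : z < l := Fin.mk_lt_mk.mpr (by omega)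
  have hd : lam z - lam l ≠ 0 := (sub_pos.mpr (hord z l hzl)).ne'
  have hd' : lam' z - lam' l ≠ 0 := (sub_pos.mpr (hord' z l hzl)).ne'
  have hcross (i : Fin n) :
      (lam i - lam l) * (lam' z - lam' l) = (lam' i - lam' l) * (lam z - lam l) := by
    by_cases h0 : (i : ℕ) = 0
    · obtain rfl : i = z := Fin.ext h0
      ring
    by_cases h1 : (i : ℕ) = n - 1
    · obtain rfl : i = l := Fin.ext h1
      ring
    · exact (div_eq_div_iff hd hd').mp (hratio i (by omega) (by omega))
  set a := (lam' z - lam' l) / (lam z - lam l) with ha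
  have haff : lam' = fun i => a * lam i + (lam' l - a * lam l) := by
    funext i
    rw [ha]
    field_simp
    linarith [hcross i]
  rw [haff]
  exact (Tmap_affine lam p _ (div_ne_zero hd' hd) hp.1.2).symm

end
end

section
/- (Akaike's variance monotonicity) Let λ₁ > ⋯ > λₙ > 0 and let p ∈ Δₙ be a non-vertex probability vector. Then the variance of the random variable taking value λ_i with probability T(p)_i is at least the variance of the random variable taking value λ_i with probability p_i: Σ_i T(p)_i (λ_i − λ̄(T(p)))² ≥ Σ_i p_i (λ_i − λ̄(p))², where λ̄(q) = Σ_j λ_j q_j. -/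
open MeasureTheory Filter Finset Real Metric

noncomputable section

/-- The second moment of `lam` under `Tmap lam p` about any point `c` is at least the variance
of `lam` under `p`. -/
theorem variance_le_sum_Tmap_mul_sq {n : ℕ} (lam p : Fin n → ℝ)
    (hp : p ∈ stdSimplex ℝ (Fin n)) (c : ℝ) :
    ∑ i, p i * (lam i - lamMean lam p) ^ 2 ≤ ∑ i, Tmap lam p i * (lam i - c) ^ 2 := by
  obtain ⟨hp0, hp1⟩ := hp
  set m := lamMean lam p with hm
  set V := ∑ i, p i * (lam i - m) ^ 2 with hV
  have hT : ∑ i, Tmap lam p i * (lam i - c) ^ 2 =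
      (∑ i, p i * (lam i - m) ^ 2 * (lam i - c) ^ 2) / V := by
    simp only [Tmap, ← hm, sub_sq_comm m, ← hV, Finset.sum_div, div_mul_eq_mul_div]
  have hV0 : 0 ≤ V := Finset.sum_nonneg fun i _ => mul_nonneg (hp0 i) (sq_nonneg _)
  rcases hV0.eq_or_lt with h | h
  · rw [hT, ← h, div_zero]
  have hmean : ∑ i, p i * (lam i - m) = 0 := by
    simp only [mul_sub, Finset.sum_sub_distrib, ← Finset.sum_mul, hp1, one_mul]
    simp only [hm, lamMean, mul_comm, sub_self]
  have hnonneg : 0 ≤ ∑ i, p i * ((lam i - m) * (lam i - c) - V) ^ 2 :=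
    Finset.sum_nonneg fun i _ => mul_nonneg (hp0 i) (sq_nonneg _)
  have hexpand : ∑ i, p i * ((lam i - m) * (lam i - c) - V) ^ 2 =
      ∑ i, p i * (lam i - m) ^ 2 * (lam i - c) ^ 2 - V * V := by
    calc
      _ = ∑ i, (p i * (lam i - m) ^ 2 * (lam i - c) ^ 2 - 2 * V * (p i * (lam i - m) ^ 2)
            - 2 * V * (m - c) * (p i * (lam i - m)) + V ^ 2 * p i) :=
        Finset.sum_congr rfl fun i _ => by ring
      _ = _ := by
        rw [Finset.sum_add_distrib, Finset.sum_sub_distrib, Finset.sum_sub_distrib,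
          ← Finset.mul_sum, ← Finset.mul_sum, ← Finset.mul_sum, hmean, hp1, ← hV]
        ring
  rw [hT, le_div_iff₀ h]
  linarith

/-- Akaike's variance monotonicity: the variance of `λ` under `T(p)` is at
least the variance of `λ` under `p`. -/
theorem variance_Tmap_ge (n : ℕ) (hn : 2 ≤ n) (lam : Fin n → ℝ)
    (hord : ∀ i j : Fin n, i < j → lam j < lam i)
    (hpos : 0 < lam ⟨n - 1, by omega⟩)
    (p : Fin n → ℝ) (hp : memDomT p) :
    ∑ i, p i * (lam i - lamMean lam p) ^ 2 ≤
      ∑ i, Tmap lam p i * (lam i - lamMean lam (Tmap lam p)) ^ 2 :=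
  variance_le_sum_Tmap_mul_sq lam p hp.1 _

end
end

section
/- Let λ₁ > ⋯ > λₙ > 0. If p ∈ Δₙ is not a vertex of the simplex (equivalently, the random variable taking value λ_i with probability p_i has positive variance, so T(p) is well defined), then T(p) ∈ Δₙ is also not a vertex; consequently all iterates T^k(p), k ≥ 0, are well defined and lie in dom(T). -/
open MeasureTheory Filter Finset Real Metric

noncomputable section

theorem sum_mul_lamMean_sub {n : ℕ} (lam : Fin n → ℝ) {p : Fin n → ℝ} (hp : ∑ i, p i = 1) :
    ∑ j, p j * (lamMean lam p - lam j) = 0 := by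
  simp only [mul_sub, sum_sub_distrib, ← sum_mul, hp, one_mul, lamMean, mul_comm, sub_self]

theorem variance_pos_of_memDomT {n : ℕ} {lam : Fin n → ℝ} (hlam : Function.Injective lam)
    {p : Fin n → ℝ} (hp : memDomT p) : 0 < ∑ j, p j * (lamMean lam p - lam j) ^ 2 := by
  obtain ⟨⟨hnonneg, hsum⟩, hvertex⟩ := hp
  have hterm : ∀ j ∈ univ, 0 ≤ p j * (lamMean lam p - lam j) ^ 2 :=
    fun j _ => mul_nonneg (hnonneg j) (sq_nonneg _)
  refine (sum_nonneg hterm).lt_of_ne' fun hzero => ?_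
  have hall : ∀ j, p j = 0 ∨ lamMean lam p = lam j := fun j => by
    simpa [sub_eq_zero] using (sum_eq_zero_iff_of_nonneg hterm).1 hzero j (mem_univ j)
  obtain ⟨i, -, hi⟩ : ∃ i ∈ univ, p i ≠ 0 := exists_ne_zero_of_sum_ne_zero (by simp [hsum])
  have hne : ∀ j, j ≠ i → p j = 0 := fun j hji => (hall j).resolve_right fun h =>
    hji (hlam (h.symm.trans ((hall i).resolve_left hi)))
  refine hvertex i (funext fun j => ?_)
  obtain rfl | hji := eq_or_ne j i
  · rw [Pi.single_eq_same, ← hsum, Fintype.sum_eq_single j hne]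
  · rw [Pi.single_eq_of_ne hji, hne j hji]

theorem memDomT.tmap {n : ℕ} {lam : Fin n → ℝ} (hlam : Function.Injective lam)
    {p : Fin n → ℝ} (hp : memDomT p) : memDomT (Tmap lam p) := by
  have hV := variance_pos_of_memDomT hlam hp
  refine ⟨⟨fun i => div_nonneg (mul_nonneg (hp.1.1 i) (sq_nonneg _)) hV.le, ?_⟩, fun i h => ?_⟩
  · simp only [Tmap, ← sum_div, div_self hV.ne']
  · have hne : ∀ j, j ≠ i → p j * (lamMean lam p - lam j) = 0 := fun j hji => by
      simpa [Tmap, hV.ne', hji] using congrFun h j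
    have hi := sum_mul_lamMean_sub lam hp.1.2
    rw [Fintype.sum_eq_single i hne] at hi
    have hTi := congrFun h i
    rw [Pi.single_eq_same, Tmap, sq, ← mul_assoc, hi, zero_mul, zero_div] at hTi
    exact zero_ne_one hTi

/-- `dom(T)` is invariant under `T`; consequently all iterates `T^k(p)` are
well defined and lie in `dom(T)`. -/
theorem Tmap_mem_domT (n : ℕ) (hn : 2 ≤ n) (lam : Fin n → ℝ)
    (hord : ∀ i j : Fin n, i < j → lam j < lam i)
    (hpos : 0 < lam ⟨n - 1, by omega⟩)
    (p : Fin n → ℝ) (hp : memDomT p) :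
    memDomT (Tmap lam p) ∧ ∀ k : ℕ, memDomT ((Tmap lam)^[k] p) := by
  have hlam : Function.Injective lam :=
    StrictAnti.injective fun i j hij => hord i j hij
  refine ⟨hp.tmap hlam, fun k => ?_⟩
  induction k with
  | zero => exact hp
  | succ k ih =>
    rw [Function.iterate_succ_apply']
    exact ih.tmap hlam

end
end
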